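/- Let k be a field of characteristic 2 and let F be a field extension of k. Let a₁, a₂, a₃, a₄ ∈ F and b₁, b₂, b₃, b₄ ∈ Fˣ be such that the tensor product [a₁,b₁)_F ⊗_F [a₂,b₂)_F ⊗_F [a₃,b₃)_F ⊗_F [a₄,b₄)_F is split. Then there exist an intermediate field L with k ⊆ L ⊆ F whose transcendence degree over k is at most 5, and elements a'₁, a'₂, a'₃, a'₄ ∈ L and b'₁, b'₂, b'₃, b'₄ ∈ L \ {0} such that [a'ᵢ,b'ᵢ)_F ≅ [aᵢ,bᵢ)_F as F-algebras for each 1 ≤ i ≤ 4, and the tensor product [a'₁,b'₁)_L ⊗_L [a'₂,b'₂)_L ⊗_L [a'₃,b'₃)_L ⊗_L [a'₄,b'₄)_L is split over L. -/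

import Mathlib

open FreeAlgebra in
inductive QuatRel (F : Type*) [Field F] (a b : F) :
    FreeAlgebra F (Fin 2) → FreeAlgebra F (Fin 2) → Prop
  | u_sq : QuatRel F a b (ι F 0 * ι F 0 - ι F 0) (algebraMap F _ a)
  | v_sq : QuatRel F a b (ι F 1 * ι F 1) (algebraMap F _ b)
  | vu : QuatRel F a b (ι F 1 * ι F 0) ((1 - ι F 0) * ι F 1)

/-- The quaternion algebra `[a,b)_F` over a field of characteristic `2`:
generated by `u, v` with `u² - u = a`, `v² = b`, `vu = (1-u)v`. -/
def QuatAlg (F : Type*) [Field F] (a b : F) : Type _ :=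
  RingQuot (QuatRel F a b)

instance (F : Type*) [Field F] (a b : F) : Ring (QuatAlg F a b) :=
  inferInstanceAs (Ring (RingQuot (QuatRel F a b)))

instance (F : Type*) [Field F] (a b : F) : Algebra F (QuatAlg F a b) :=
  inferInstanceAs (Algebra F (RingQuot (QuatRel F a b)))

open scoped TensorProduct

/-- The transcendence degree of `L` over `k`: the supremum of cardinalities of
algebraically independent subsets of `L`. -/
noncomputable def trdeg (k L : Type*) [CommRing k] [CommRing L] [Algebra k L] : Cardinal :=
  ⨆ s : { s : Set L // AlgebraicIndependent k ((↑) : s → L) }, Cardinal.mk s.1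

set_option linter.unusedSimpArgs false
set_option linter.unusedSectionVars false

open Module

section Clifford

variable {F : Type*} [Field F] {A : Type*} [Ring A] [Algebra F A]

/-- `x, y` generate a Clifford algebra of the binary quadratic form `m X² + X Y + n Y²`
(in characteristic `2`). -/
structure IsCliff (m n : F) (x y : A) : Prop where
  xx : x * x = m • (1 : A)
  yy : y * y = n • (1 : A)
  yx : y * x = 1 + x * y

namespace IsCliff

variable {m n : F} {x y : A}

theorem xx' (h : IsCliff m n x y) (z : A) : x * (x * z) = m • z := by
  rw [← mul_assoc, h.xx, smul_mul_assoc, one_mul]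

theorem yy' (h : IsCliff m n x y) (z : A) : y * (y * z) = n • z := by
  rw [← mul_assoc, h.yy, smul_mul_assoc, one_mul]

theorem yx' (h : IsCliff m n x y) (z : A) : y * (x * z) = z + x * (y * z) := by
  rw [← mul_assoc, h.yx, add_mul, one_mul, mul_assoc]

theorem map (h : IsCliff m n x y) {B : Type*} [Ring B] [Algebra F B] (φ : A →ₐ[F] B) :
    IsCliff m n (φ x) (φ y) where
  xx := by rw [← map_mul, h.xx, map_smul, map_one]
  yy := by rw [← map_mul, h.yy, map_smul, map_one]
  yx := by rw [← map_mul, h.yx, map_add, map_mul, map_one]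

variable [CharP F 2]

theorem swap (h : IsCliff m n x y) : IsCliff n m y x where
  xx := h.yy
  yy := h.xx
  yx := by
    have h2 : (1 : A) + 1 = 0 := by
      rw [← two_smul F, CharTwo.two_eq_zero, zero_smul]
    rw [h.yx, ← add_assoc, h2, zero_add]

theorem translate (h : IsCliff m n x y) (c d : F) :
    IsCliff (m + c ^ 2) (n + d ^ 2) (x + c • (1 : A)) (y + d • (1 : A)) := by
  have h2 : (2 : F) = 0 := CharTwo.two_eq_zero
  constructor <;>
  · simp only [mul_add, add_mul, h.xx, h.yy, h.yx, smul_mul_assoc, mul_smul_comm, mul_one,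
      one_mul]
    match_scalars <;> grind

theorem shear (h : IsCliff m n x y) (c : F) :
    IsCliff m (n + c + c ^ 2 * m) x (y + c • x) := by
  have h2 : (2 : F) = 0 := CharTwo.two_eq_zero
  refine ⟨h.xx, ?_, ?_⟩ <;>
  · simp only [mul_add, add_mul, h.xx, h.yy, h.yx, smul_mul_assoc, mul_smul_comm]
    match_scalars <;> grind

end IsCliff

/-- Two pairs of Clifford generators which commute with each other. -/
structure IsBiCliff (m n r s : F) (x₁ y₁ x₂ y₂ : A) : Prop where
  left : IsCliff m n x₁ y₁
  right : IsCliff r s x₂ y₂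
  xx : x₂ * x₁ = x₁ * x₂
  xy : x₂ * y₁ = y₁ * x₂
  yx : y₂ * x₁ = x₁ * y₂
  yy : y₂ * y₁ = y₁ * y₂

namespace IsBiCliff

variable {m n r s : F} {x₁ y₁ x₂ y₂ : A}

theorem xx' (h : IsBiCliff m n r s x₁ y₁ x₂ y₂) (z : A) : x₂ * (x₁ * z) = x₁ * (x₂ * z) := by
  rw [← mul_assoc, h.xx, mul_assoc]

theorem xy' (h : IsBiCliff m n r s x₁ y₁ x₂ y₂) (z : A) : x₂ * (y₁ * z) = y₁ * (x₂ * z) := by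
  rw [← mul_assoc, h.xy, mul_assoc]

theorem yx' (h : IsBiCliff m n r s x₁ y₁ x₂ y₂) (z : A) : y₂ * (x₁ * z) = x₁ * (y₂ * z) := by
  rw [← mul_assoc, h.yx, mul_assoc]

theorem yy' (h : IsBiCliff m n r s x₁ y₁ x₂ y₂) (z : A) : y₂ * (y₁ * z) = y₁ * (y₂ * z) := by
  rw [← mul_assoc, h.yy, mul_assoc]

theorem map (h : IsBiCliff m n r s x₁ y₁ x₂ y₂) {B : Type*} [Ring B] [Algebra F B]
    (φ : A →ₐ[F] B) : IsBiCliff m n r s (φ x₁) (φ y₁) (φ x₂) (φ y₂) where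
  left := h.left.map φ
  right := h.right.map φ
  xx := by rw [← map_mul, h.xx, map_mul]
  xy := by rw [← map_mul, h.xy, map_mul]
  yx := by rw [← map_mul, h.yx, map_mul]
  yy := by rw [← map_mul, h.yy, map_mul]

theorem swap (h : IsBiCliff m n r s x₁ y₁ x₂ y₂) : IsBiCliff r s m n x₂ y₂ x₁ y₁ where
  left := h.right
  right := h.left
  xx := h.xx.symm
  xy := h.yx.symm
  yx := h.xy.symm
  yy := h.yy.symm

theorem translate [CharP F 2] (h : IsBiCliff m n r s x₁ y₁ x₂ y₂) (a b c d : F) :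
    IsBiCliff (m + a ^ 2) (n + b ^ 2) (r + c ^ 2) (s + d ^ 2)
      (x₁ + a • (1 : A)) (y₁ + b • (1 : A)) (x₂ + c • (1 : A)) (y₂ + d • (1 : A)) where
  left := h.left.translate a b
  right := h.right.translate c d
  xx := by
    simp only [mul_add, add_mul, h.xx, smul_mul_assoc, mul_smul_comm, mul_one, one_mul]
    module
  xy := by
    simp only [mul_add, add_mul, h.xy, smul_mul_assoc, mul_smul_comm, mul_one, one_mul]
    module
  yx := by
    simp only [mul_add, add_mul, h.yx, smul_mul_assoc, mul_smul_comm, mul_one, one_mul]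
    module
  yy := by
    simp only [mul_add, add_mul, h.yy, smul_mul_assoc, mul_smul_comm, mul_one, one_mul]
    module

end IsBiCliff

end Clifford

section Generators

variable {F : Type*} [Field F]

namespace QuatAlg

variable (a b : F)

/-- The generator `u` of `[a, b)`. -/
def u : QuatAlg F a b := RingQuot.mkAlgHom F (QuatRel F a b) (FreeAlgebra.ι F 0)

/-- The generator `v` of `[a, b)`. -/
def v : QuatAlg F a b := RingQuot.mkAlgHom F (QuatRel F a b) (FreeAlgebra.ι F 1)

theorem u_mul_u : u a b * u a b - u a b = a • 1 := by
  have h := RingQuot.mkAlgHom_rel F (QuatRel.u_sq (F := F) (a := a) (b := b))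
  rw [map_sub, map_mul, AlgHom.commutes, Algebra.algebraMap_eq_smul_one] at h
  exact h

theorem v_mul_v : v a b * v a b = b • 1 := by
  have h := RingQuot.mkAlgHom_rel F (QuatRel.v_sq (F := F) (a := a) (b := b))
  rw [map_mul, AlgHom.commutes, Algebra.algebraMap_eq_smul_one] at h
  exact h

theorem v_mul_u : v a b * u a b = (1 - u a b) * v a b := by
  have h := RingQuot.mkAlgHom_rel F (QuatRel.vu (F := F) (a := a) (b := b))
  rw [map_mul, map_mul, map_sub, map_one] at h
  exact h

variable {a b}

/-- The universal property of `[a, b)`. -/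
def lift {A : Type*} [Ring A] [Algebra F A] (p q : A) (hp : p * p - p = a • 1)
    (hq : q * q = b • 1) (hqp : q * p = (1 - p) * q) : QuatAlg F a b →ₐ[F] A :=
  RingQuot.liftAlgHom F ⟨FreeAlgebra.lift F ![p, q], by
    intro x y h
    cases h <;> simp [Algebra.algebraMap_eq_smul_one, *]⟩

section lift

variable {A : Type*} [Ring A] [Algebra F A] (p q : A) (hp : p * p - p = a • 1)
    (hq : q * q = b • 1) (hqp : q * p = (1 - p) * q)

@[simp]
theorem lift_u : lift p q hp hq hqp (u a b) = p :=
  (RingQuot.liftAlgHom_mkAlgHom_apply ..).trans (by simp)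

@[simp]
theorem lift_v : lift p q hp hq hqp (v a b) = q :=
  (RingQuot.liftAlgHom_mkAlgHom_apply ..).trans (by simp)

end lift

theorem exists_hom {A : Type*} [Ring A] [Algebra F A] {p q : A} (hp : p * p = p + a • 1)
    (hq : q * q = b • 1) (hqp : q * p = q - p * q) :
    ∃ φ : QuatAlg F a b →ₐ[F] A, φ (u a b) = p ∧ φ (v a b) = q :=
  ⟨lift p q (by rw [hp, add_sub_cancel_left]) hq (by rw [hqp, sub_mul, one_mul]),
    lift_u .., lift_v ..⟩

theorem adjoin_u_v : Algebra.adjoin F {u a b, v a b} = ⊤ := by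
  have h : Set.range (FreeAlgebra.ι F : Fin 2 → _) = {FreeAlgebra.ι F 0, FreeAlgebra.ι F 1} := by
    ext; simp [Fin.exists_fin_two, eq_comm]
  have h' := congrArg (Subalgebra.map (RingQuot.mkAlgHom F (QuatRel F a b)))
    (FreeAlgebra.adjoin_range_ι F (Fin 2))
  rw [h, AlgHom.map_adjoin, Set.image_pair, Algebra.map_top,
    (AlgHom.range_eq_top _).2 (RingQuot.mkAlgHom_surjective F _)] at h'
  exact h'

end QuatAlg

open Classical in
/-- The slot `b` of a quaternion algebra isomorphic to the Clifford algebra of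
`m X² + X Y + n Y²`. -/
noncomputable def cliffSlot (m n : F) : F := if m ≠ 0 then m else if n ≠ 0 then n else 1

theorem cliffSlot_ne_zero (m n : F) : cliffSlot m n ≠ 0 := by
  unfold cliffSlot; split_ifs <;> simp_all

theorem cliffSlot_of_ne_zero {m : F} (n : F) (hm : m ≠ 0) : cliffSlot m n = m := by
  simp [cliffSlot, hm]

variable (F) in
/-- The Clifford algebra of `m X² + X Y + n Y²`, as a quaternion algebra. -/
abbrev CliffAlg (m n : F) : Type _ := QuatAlg F (m * n) (cliffSlot m n)

namespace CliffAlg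

open QuatAlg Classical

variable (m n : F)

/-- The first Clifford generator. -/
noncomputable def x : CliffAlg F m n :=
  if m ≠ 0 then v _ _ else if n ≠ 0 then n⁻¹ • (u _ _ * v _ _) else v _ _ + u _ _ * v _ _

/-- The second Clifford generator. -/
noncomputable def y : CliffAlg F m n :=
  if m ≠ 0 then m⁻¹ • (u _ _ * v _ _) else if n ≠ 0 then v _ _ else u _ _ * v _ _

variable [CharP F 2]

theorem isCliff_of_relations {A : Type*} [Ring A] [Algebra F A] {a b : F} (hb : b ≠ 0)
    {p q : A} (hp : p * p = p + a • 1) (hq : q * q = b • 1) (hqp : q * p = q - p * q) :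
    IsCliff b (b⁻¹ * a) q (b⁻¹ • (p * q)) := by
  have h2 : (2 : F) = 0 := CharTwo.two_eq_zero
  have hp' (z : A) : p * (p * z) = p * z + a • z := by
    rw [← mul_assoc, hp, add_mul, smul_mul_assoc, one_mul]
  have hqp' (z : A) : q * (p * z) = q * z - p * (q * z) := by
    rw [← mul_assoc, hqp, sub_mul, mul_assoc]
  refine ⟨hq, ?_, ?_⟩ <;>
  · simp only [mul_add, add_mul, mul_assoc, hp, hp', hq, hqp, hqp', smul_mul_assoc,
      mul_smul_comm, mul_one, mul_sub]
    match_scalars <;> grind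

theorem x_y_of_ne {m : F} (n : F) (hm : m ≠ 0) :
    cliffSlot m n = m ∧ x m n = v _ _ ∧ y m n = m⁻¹ • (u _ _ * v _ _) :=
  ⟨if_pos hm, if_pos hm, if_pos hm⟩

theorem x_y_of_eq_of_ne {m n : F} (hm : m = 0) (hn : n ≠ 0) :
    cliffSlot m n = n ∧ x m n = n⁻¹ • (u _ _ * v _ _) ∧ y m n = v _ _ :=
  ⟨(if_neg (not_not.2 hm)).trans (if_pos hn), (if_neg (not_not.2 hm)).trans (if_pos hn),
    (if_neg (not_not.2 hm)).trans (if_pos hn)⟩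

theorem x_y_of_eq_of_eq {m n : F} (hm : m = 0) (hn : n = 0) :
    cliffSlot m n = 1 ∧ x m n = v _ _ + u _ _ * v _ _ ∧ y m n = u _ _ * v _ _ :=
  ⟨(if_neg (not_not.2 hm)).trans (if_neg (not_not.2 hn)),
    (if_neg (not_not.2 hm)).trans (if_neg (not_not.2 hn)),
    (if_neg (not_not.2 hm)).trans (if_neg (not_not.2 hn))⟩

theorem isCliff : IsCliff m n (x m n) (y m n) := by
  have hp := u_mul_u (m * n) (cliffSlot m n)
  have hq := v_mul_v (m * n) (cliffSlot m n)
  have hqp := v_mul_u (m * n) (cliffSlot m n)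
  rw [sub_eq_iff_eq_add, add_comm] at hp
  rw [sub_mul, one_mul] at hqp
  have key := isCliff_of_relations (cliffSlot_ne_zero m n) hp hq hqp
  by_cases hm : m = 0
  · by_cases hn : n = 0
    · obtain ⟨h1, hx, hy⟩ := x_y_of_eq_of_eq hm hn
      rw [hx, hy]
      convert (key.swap.shear 1).swap using 1
      · rw [h1, hm, zero_mul, mul_zero, mul_zero, add_zero, CharTwo.add_self_eq_zero]
      · rw [hn, mul_zero, mul_zero]
      · rw [one_smul, congrArg Inv.inv h1, inv_one, one_smul]
      · rw [congrArg Inv.inv h1, inv_one, one_smul]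
    · obtain ⟨h1, hx, hy⟩ := x_y_of_eq_of_ne hm hn
      rw [hx, hy]
      convert key.swap using 1
      · rw [h1, mul_left_comm, inv_mul_cancel₀ hn, mul_one]
      · exact h1.symm
      · rw [congrArg Inv.inv h1]
  · obtain ⟨h1, hx, hy⟩ := x_y_of_ne n hm
    rw [hx, hy]
    convert key using 1
    · exact h1.symm
    · rw [h1, inv_mul_cancel_left₀ hm]
    · rw [congrArg Inv.inv h1]

variable {m n} {A : Type*} [Ring A] [Algebra F A]

theorem exists_lift {p q : A} (h : IsCliff m n p q) :
    ∃ φ : CliffAlg F m n →ₐ[F] A, φ (x m n) = p ∧ φ (y m n) = q := by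
  have h2 : (2 : F) = 0 := CharTwo.two_eq_zero
  by_cases hm : m = 0
  · by_cases hn : n = 0
    · obtain ⟨h1, hx, hy⟩ := x_y_of_eq_of_eq hm hn
      obtain ⟨φ, hu, hv⟩ : ∃ φ : CliffAlg F m n →ₐ[F] A, φ (u _ _) = q * p ∧
          φ (v _ _) = p + q := by
        refine exists_hom ?_ ?_ ?_ <;>
        · simp only [mul_add, add_mul, mul_sub, sub_mul, mul_assoc, h.xx, h.yy, h.yx, h.xx', h.yy',
            h.yx', smul_mul_assoc, mul_smul_comm, mul_one, one_mul]
          match_scalars <;> grind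
      refine ⟨φ, ?_, ?_⟩
      · rw [hx, map_add, map_mul, hu, hv]
        simp only [mul_add, add_mul, mul_sub, sub_mul, mul_assoc, h.xx, h.yy, h.yx, h.xx', h.yy',
          h.yx', smul_mul_assoc, mul_smul_comm, mul_one, one_mul]
        match_scalars <;> grind
      · rw [hy, map_mul, hu, hv]
        simp only [mul_add, add_mul, mul_sub, sub_mul, mul_assoc, h.xx, h.yy, h.yx, h.xx', h.yy',
          h.yx', smul_mul_assoc, mul_smul_comm, mul_one, one_mul]
        match_scalars <;> grind
    · obtain ⟨h1, hx, hy⟩ := x_y_of_eq_of_ne hm hn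
      obtain ⟨φ, hu, hv⟩ : ∃ φ : CliffAlg F m n →ₐ[F] A, φ (u _ _) = p * q ∧
          φ (v _ _) = q := by
        refine exists_hom ?_ ?_ ?_ <;>
        · simp only [mul_add, add_mul, mul_sub, sub_mul, mul_assoc, h.xx, h.yy, h.yx, h.xx', h.yy',
            h.yx', smul_mul_assoc, mul_smul_comm, mul_one, one_mul]
          match_scalars <;> grind
      refine ⟨φ, ?_, by rw [hy, hv]⟩
      rw [hx, map_smul, map_mul, hu, hv, mul_assoc, h.yy, mul_smul_comm, mul_one,
        inv_smul_smul₀ hn]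
  · obtain ⟨h1, hx, hy⟩ := x_y_of_ne n hm
    obtain ⟨φ, hu, hv⟩ : ∃ φ : CliffAlg F m n →ₐ[F] A, φ (u _ _) = q * p ∧
        φ (v _ _) = p := by
      refine exists_hom ?_ ?_ ?_ <;>
      · simp only [mul_add, add_mul, mul_sub, sub_mul, mul_assoc, h.xx, h.yy, h.yx, h.xx', h.yy',
          h.yx', smul_mul_assoc, mul_smul_comm, mul_one, one_mul]
        match_scalars <;> grind
    refine ⟨φ, by rw [hx, hv], ?_⟩
    rw [hy, map_smul, map_mul, hu, hv, mul_assoc, h.xx, mul_smul_comm, mul_one,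
      inv_smul_smul₀ hm]

variable (m n)

theorem adjoin_eq_top : Algebra.adjoin F {x m n, y m n} = ⊤ := by
  set S := Algebra.adjoin F {x m n, y m n} with hS
  have hxS : x m n ∈ S := Algebra.subset_adjoin (by simp)
  have hyS : y m n ∈ S := Algebra.subset_adjoin (by simp)
  have hp := u_mul_u (m * n) (cliffSlot m n)
  have hq := v_mul_v (m * n) (cliffSlot m n)
  have hne := cliffSlot_ne_zero m n
  have huv : v (m * n) (cliffSlot m n) ∈ S ∧ u (m * n) (cliffSlot m n) *
      v (m * n) (cliffSlot m n) ∈ S := by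
    by_cases hm : m = 0
    · by_cases hn : n = 0
      · obtain ⟨h1, hx, hy⟩ := x_y_of_eq_of_eq hm hn
        exact ⟨by simpa [hx, hy] using S.sub_mem hxS hyS, hy ▸ hyS⟩
      · obtain ⟨h1, hx, hy⟩ := x_y_of_eq_of_ne hm hn
        exact ⟨hy ▸ hyS, by simpa [hx, smul_smul, hn] using S.smul_mem hxS n⟩
    · obtain ⟨h1, hx, hy⟩ := x_y_of_ne n hm
      exact ⟨hx ▸ hxS, by simpa [hy, smul_smul, hm] using S.smul_mem hyS m⟩
  have hu : u (m * n) (cliffSlot m n) ∈ S := by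
    have := S.smul_mem (S.mul_mem huv.2 huv.1) (cliffSlot m n)⁻¹
    rwa [mul_assoc, hq, mul_smul_comm, smul_smul, inv_mul_cancel₀ hne, one_smul, mul_one] at this
  rw [← top_le_iff, ← adjoin_u_v, Algebra.adjoin_le_iff]
  rintro z (rfl | rfl)
  exacts [hu, huv.1]

end CliffAlg

end Generators

section Simplicity

variable {F : Type*} [Field F] [CharP F 2]

namespace IsCliff

variable {A : Type*} [Ring A] [Algebra F A] {m n : F} {x y : A}

theorem exists_eq_of_mem_adjoin (h : IsCliff m n x y) {z : A} (hz : z ∈ Algebra.adjoin F {x, y}) :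
    ∃ a b c d : F, z = a • (1 : A) + b • x + c • y + d • (x * y) := by
  have h2 : (2 : F) = 0 := CharTwo.two_eq_zero
  induction hz using Algebra.adjoin_induction with
  | mem w hw =>
    rcases hw with rfl | rfl
    · exact ⟨0, 1, 0, 0, by module⟩
    · exact ⟨0, 0, 1, 0, by module⟩
  | algebraMap r => exact ⟨r, 0, 0, 0, by rw [Algebra.algebraMap_eq_smul_one]; module⟩
  | add p q _ _ hp hq =>
    obtain ⟨a, b, c, d, rfl⟩ := hp
    obtain ⟨a', b', c', d', rfl⟩ := hq
    exact ⟨a + a', b + b', c + c', d + d', by module⟩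
  | mul p q _ _ hp hq =>
    obtain ⟨a, b, c, d, rfl⟩ := hp
    obtain ⟨a', b', c', d', rfl⟩ := hq
    refine ⟨a * a' + m * b * b' + n * c * c' + c * b' + m * n * d * d',
      a * b' + b * a' + n * d * c' + n * c * d' + d * b',
      a * c' + c * a' + m * b * d' + m * d * b' + c * d',
      a * d' + d * a' + b * c' + c * b' + d * d', ?_⟩
    simp only [mul_add, add_mul, mul_assoc, h.xx, h.yy, h.yx, h.xx', h.yy', h.yx',
      smul_mul_assoc, mul_smul_comm, mul_one, one_mul]
    match_scalars <;> grind

/-- The coefficients of an element written in terms of Clifford generators, over a commuting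
subring, are obtained by iterated commutators. -/
theorem commutator (h : IsCliff m n x y) {r₀ r₁ r₂ r₃ : A} (h0x : Commute r₀ x) (h0y : Commute r₀ y)
    (h1x : Commute r₁ x) (h1y : Commute r₁ y) (h2x : Commute r₂ x) (h2y : Commute r₂ y)
    (h3x : Commute r₃ x) (h3y : Commute r₃ y) {z : A}
    (hz : z = r₀ + r₁ * x + r₂ * y + r₃ * (x * y)) :
    x * z + z * x = r₂ + r₃ * x ∧ y * z + z * y = r₁ + r₃ * y ∧
      y * (x * z + z * x) + (x * z + z * x) * y = r₃ := by
  have h2 : (2 : F) = 0 := CharTwo.two_eq_zero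
  have e (a : A) : a + a = 0 := by rw [← two_smul F, h2, zero_smul]
  have h3' (w : A) : x * (r₃ * w) = r₃ * (x * w) := by rw [← mul_assoc, ← h3x.eq, mul_assoc]
  have h3'' (w : A) : y * (r₃ * w) = r₃ * (y * w) := by rw [← mul_assoc, ← h3y.eq, mul_assoc]
  have h2' (w : A) : x * (r₂ * w) = r₂ * (x * w) := by rw [← mul_assoc, ← h2x.eq, mul_assoc]
  have h2'' (w : A) : y * (r₂ * w) = r₂ * (y * w) := by rw [← mul_assoc, ← h2y.eq, mul_assoc]
  have h1' (w : A) : x * (r₁ * w) = r₁ * (x * w) := by rw [← mul_assoc, ← h1x.eq, mul_assoc]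
  have h1'' (w : A) : y * (r₁ * w) = r₁ * (y * w) := by rw [← mul_assoc, ← h1y.eq, mul_assoc]
  have key1 : x * z + z * x = r₂ + r₃ * x := by
    subst hz
    simp only [mul_add, add_mul, mul_assoc, h.xx, h.yy, h.yx, h.xx', h.yy', h.yx',
      smul_mul_assoc, mul_smul_comm, mul_one, one_mul, ← h0x.eq, h3', h2', h1']
    match_scalars <;> grind
  have key2 : y * z + z * y = r₁ + r₃ * y := by
    subst hz
    simp only [mul_add, add_mul, mul_assoc, h.xx, h.yy, h.yx, h.xx', h.yy', h.yx',
      smul_mul_assoc, mul_smul_comm, mul_one, one_mul, ← h0y.eq, h3'', h2'', h1'']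
    match_scalars <;> grind
  refine ⟨key1, key2, ?_⟩
  rw [key1]
  simp only [mul_add, add_mul, mul_assoc, h.yx, mul_one, ← h2y.eq, h3'']
  rw [add_add_add_comm, e, zero_add, add_assoc, e, add_zero]

theorem eq_zero_of_sum_eq_zero [Nontrivial A] (h : IsCliff m n x y) {a b c d : F}
    (h0 : a • (1 : A) + b • x + c • y + d • (x * y) = 0) : a = 0 ∧ b = 0 ∧ c = 0 ∧ d = 0 := by
  have hc (r : F) (z : A) : Commute (r • (1 : A)) z :=
    (Commute.one_left z).smul_left r
  have hs (r : F) : r • (1 : A) = 0 ↔ r = 0 := by simp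
  obtain ⟨h1, h2, h3⟩ := h.commutator (r₀ := a • 1) (r₁ := b • 1) (r₂ := c • 1) (r₃ := d • 1)
    (hc _ _) (hc _ _) (hc _ _) (hc _ _) (hc _ _) (hc _ _) (hc _ _) (hc _ _) (z := 0)
    (by simpa only [smul_one_mul] using h0.symm)
  simp only [mul_zero, zero_mul, add_zero] at h1 h2 h3
  have hd := (hs d).1 h3.symm
  subst hd
  simp only [zero_smul, zero_mul, add_zero] at h1 h2
  have hc := (hs c).1 h1.symm
  have hb := (hs b).1 h2.symm
  subst hc hb
  exact ⟨(hs a).1 (by simpa using h0), rfl, rfl, rfl⟩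

theorem isSimpleRing [Nontrivial A] (h : IsCliff m n x y) {R : Type*} [Ring R] [IsSimpleRing R]
    (ρ : R →+* A) (hx : ∀ r, Commute (ρ r) x) (hy : ∀ r, Commute (ρ r) y)
    (hz : ∀ z, ∃ r₀ r₁ r₂ r₃, z = ρ r₀ + ρ r₁ * x + ρ r₂ * y + ρ r₃ * (x * y)) :
    IsSimpleRing A := by
  refine IsSimpleRing.of_eq_bot_or_eq_top fun I ↦ or_iff_not_imp_left.2 fun hI ↦ ?_
  have key (r : R) (hr : ρ r ∈ I) (hr0 : r ≠ 0) : I = ⊤ := by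
    have h1 : r ∈ I.comap ρ := (TwoSidedIdeal.mem_comap ρ).2 hr
    have := IsSimpleRing.one_mem_of_ne_zero_mem _ hr0 h1
    rw [TwoSidedIdeal.mem_comap, map_one] at this
    exact (TwoSidedIdeal.one_mem_iff I).1 this
  by_contra hcon
  replace key (r : R) (hr : ρ r ∈ I) : r = 0 := by_contra fun h0 ↦ hcon (key r hr h0)
  refine hI ((TwoSidedIdeal.ext fun z ↦ ?_))
  rw [TwoSidedIdeal.mem_bot]
  refine ⟨fun hzI ↦ ?_, fun h ↦ h ▸ I.zero_mem⟩
  obtain ⟨r₀, r₁, r₂, r₃, rfl⟩ := hz z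
  obtain ⟨h1, h2, h3⟩ := h.commutator (hx r₀) (hy r₀) (hx r₁) (hy r₁) (hx r₂) (hy r₂) (hx r₃)
    (hy r₃) rfl
  have hm (w z : A) (hz : z ∈ I) : w * z + z * w ∈ I :=
    I.add_mem (I.mul_mem_left _ _ hz) (I.mul_mem_right _ _ hz)
  have e3 := key r₃ (h3 ▸ hm _ _ (hm _ _ hzI))
  subst e3
  simp only [map_zero, zero_mul, add_zero] at h1 h2 hzI
  have e2 := key r₂ (h1 ▸ hm _ _ hzI)
  have e1 := key r₁ (h2 ▸ hm _ _ hzI)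
  subst e1 e2
  simp only [map_zero, zero_mul, add_zero] at hzI
  rw [key r₀ hzI]
  simp

end IsCliff

namespace CliffAlg

variable (m n : F)

instance : Nontrivial (CliffAlg F m n) := by
  obtain ⟨φ, -⟩ := QuatAlg.exists_hom (F := F) (a := m * n) (b := cliffSlot m n)
    (p := (⟨0, 1, 0, 0⟩ : QuaternionAlgebra F (m * n) 1 (cliffSlot m n))) (q := ⟨0, 0, 1, 0⟩)
    (by ext <;> simp) (by ext <;> simp) (by ext <;> simp)
  exact φ.toRingHom.domain_nontrivial

theorem exists_eq (z : CliffAlg F m n) : ∃ a b c d : F,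
    z = a • 1 + b • x m n + c • y m n + d • (x m n * y m n) :=
  (isCliff m n).exists_eq_of_mem_adjoin (by rw [adjoin_eq_top]; trivial)

/-- The standard basis of a Clifford algebra. -/
noncomputable def basis : Basis (Fin 4) F (CliffAlg F m n) :=
  Basis.mk (v := ![1, x m n, y m n, x m n * y m n])
    (by
      rw [Fintype.linearIndependent_iff]
      intro g hg
      simp only [Fin.sum_univ_four, Matrix.cons_val] at hg
      obtain ⟨h0, h1, h2, h3⟩ := (isCliff m n).eq_zero_of_sum_eq_zero hg
      intro i
      fin_cases i <;> assumption)
    (by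
      intro z _
      obtain ⟨a, b, c, d, rfl⟩ := exists_eq m n z
      refine Submodule.add_mem _ (Submodule.add_mem _ (Submodule.add_mem _ ?_ ?_) ?_) ?_ <;>
        refine Submodule.smul_mem _ _ (Submodule.subset_span ?_)
      exacts [⟨0, rfl⟩, ⟨1, rfl⟩, ⟨2, rfl⟩, ⟨3, rfl⟩])

instance : Module.Finite F (CliffAlg F m n) := .of_basis (basis m n)

theorem finrank_eq : finrank F (CliffAlg F m n) = 4 := by
  rw [finrank_eq_card_basis (basis m n), Fintype.card_fin]

variable (R : Type*) [Ring R] [Algebra F R] [IsSimpleRing R]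

instance : IsSimpleRing (CliffAlg F m n) :=
  (isCliff m n).isSimpleRing (algebraMap F _) (fun r ↦ Algebra.commutes r _)
    (fun r ↦ Algebra.commutes r _) fun z ↦ by
      obtain ⟨a, b, c, d, rfl⟩ := exists_eq m n z
      exact ⟨a, b, c, d, by simp [Algebra.algebraMap_eq_smul_one]⟩

instance : IsSimpleRing (R ⊗[F] CliffAlg F m n) := by
  have hcm (r : R) (z : CliffAlg F m n) : Commute
      (Algebra.TensorProduct.includeLeftRingHom (R := F) (A := R) (B := CliffAlg F m n) r)
      (Algebra.TensorProduct.includeRight (R := F) (A := R) z) := by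
    simp [Commute, SemiconjBy]
  refine ((isCliff m n).map Algebra.TensorProduct.includeRight).isSimpleRing
    Algebra.TensorProduct.includeLeftRingHom (fun r ↦ hcm r _) (fun r ↦ hcm r _) fun z ↦ ?_
  induction z with
  | zero => exact ⟨0, 0, 0, 0, by simp⟩
  | tmul r w =>
    obtain ⟨a, b, c, d, rfl⟩ := exists_eq m n w
    refine ⟨a • r, b • r, c • r, d • r, ?_⟩
    simp [TensorProduct.tmul_add, TensorProduct.tmul_smul, TensorProduct.smul_tmul']
  | add p q hp hq =>
    obtain ⟨a, b, c, d, rfl⟩ := hp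
    obtain ⟨a', b', c', d', rfl⟩ := hq
    refine ⟨a + a', b + b', c + c', d + d', ?_⟩
    simp only [map_add, add_mul]
    abel

end CliffAlg

end Simplicity

section Biquaternion

variable {F : Type*} [Field F] [CharP F 2]

theorem IsCliff.commute_of_mem_adjoin {A : Type*} [Ring A] [Algebra F A] {x y z w : A}
    (hx : Commute z x) (hy : Commute z y) (hw : w ∈ Algebra.adjoin F {x, y}) : Commute z w := by
  have h : Algebra.adjoin F {x, y} ≤ Subalgebra.centralizer F {z} := by
    rw [Algebra.adjoin_le_iff]
    rintro w (rfl | rfl)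
    · rintro _ rfl
      exact hx
    · rintro _ rfl
      exact hy
  exact h hw z rfl

theorem CliffAlg.algHom_mem_adjoin {A : Type*} [Ring A] [Algebra F A] {m n : F}
    (φ : CliffAlg F m n →ₐ[F] A) (z : CliffAlg F m n) :
    φ z ∈ Algebra.adjoin F {φ (x m n), φ (y m n)} := by
  rw [← Set.image_pair, ← AlgHom.map_adjoin, adjoin_eq_top]
  exact ⟨z, trivial, rfl⟩

variable (F) in
/-- The tensor product of two Clifford algebras of binary forms. -/
abbrev BiCliffAlg (m n r s : F) : Type _ := CliffAlg F m n ⊗[F] CliffAlg F r s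

theorem BiCliffAlg.finrank_eq (m n r s : F) : finrank F (BiCliffAlg F m n r s) = 16 := by
  rw [finrank_tensorProduct, CliffAlg.finrank_eq, CliffAlg.finrank_eq]

theorem isBiCliff_tmul {A B : Type*} [Ring A] [Algebra F A] [Ring B] [Algebra F B] {m n r s : F}
    {x y : A} {z w : B} (h : IsCliff m n x y) (h' : IsCliff r s z w) :
    IsBiCliff m n r s (x ⊗ₜ[F] (1 : B)) (y ⊗ₜ[F] (1 : B)) ((1 : A) ⊗ₜ[F] z)
      ((1 : A) ⊗ₜ[F] w) where
  left := h.map (Algebra.TensorProduct.includeLeft (S := F) (R := F) (A := A) (B := B))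
  right := h'.map (Algebra.TensorProduct.includeRight (R := F) (A := A) (B := B))
  xx := by simp
  xy := by simp
  yx := by simp
  yy := by simp

open CliffAlg in
theorem BiCliffAlg.isBiCliff (m n r s : F) : IsBiCliff m n r s (A := BiCliffAlg F m n r s)
    (x m n ⊗ₜ 1) (y m n ⊗ₜ 1) (1 ⊗ₜ x r s) (1 ⊗ₜ y r s) :=
  isBiCliff_tmul (CliffAlg.isCliff m n) (CliffAlg.isCliff r s)

namespace IsBiCliff

variable {A : Type*} [Ring A] [Algebra F A] {m n r s : F} {x₁ y₁ x₂ y₂ : A}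

open CliffAlg in
theorem exists_lift (h : IsBiCliff m n r s x₁ y₁ x₂ y₂) :
    ∃ φ : BiCliffAlg F m n r s →ₐ[F] A, φ (x m n ⊗ₜ 1) = x₁ ∧ φ (y m n ⊗ₜ 1) = y₁ ∧
      φ (1 ⊗ₜ x r s) = x₂ ∧ φ (1 ⊗ₜ y r s) = y₂ := by
  obtain ⟨φ, hx₁, hy₁⟩ := CliffAlg.exists_lift h.left
  obtain ⟨ψ, hx₂, hy₂⟩ := CliffAlg.exists_lift h.right
  refine ⟨Algebra.TensorProduct.lift φ ψ fun z w ↦ ?_, ?_, ?_, ?_, ?_⟩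
  · have hz := CliffAlg.algHom_mem_adjoin φ z
    have hw := CliffAlg.algHom_mem_adjoin ψ w
    rw [hx₁, hy₁] at hz
    rw [hx₂, hy₂] at hw
    exact IsCliff.commute_of_mem_adjoin
      (IsCliff.commute_of_mem_adjoin h.xx h.xy hz).symm
      (IsCliff.commute_of_mem_adjoin h.yx h.yy hz).symm hw
  all_goals simp [*]

/-- The generators of an algebra of dimension `16` by two commuting Clifford pairs induce an
isomorphism with a tensor product. -/
theorem exists_equiv (h : IsBiCliff m n r s x₁ y₁ x₂ y₂) (hA : finrank F A = 16) :
    ∃ φ : BiCliffAlg F m n r s ≃ₐ[F] A, φ (CliffAlg.x m n ⊗ₜ 1) = x₁ ∧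
      φ (CliffAlg.y m n ⊗ₜ 1) = y₁ ∧ φ (1 ⊗ₜ CliffAlg.x r s) = x₂ ∧
      φ (1 ⊗ₜ CliffAlg.y r s) = y₂ := by
  obtain ⟨φ, h1, h2, h3, h4⟩ := h.exists_lift
  have : Module.Finite F A := Module.finite_of_finrank_pos (by omega)
  have : Nontrivial A := Module.nontrivial_of_finrank_pos (R := F) (by omega)
  have hinj : Function.Injective φ := φ.toRingHom.injective
  have hsurj : Function.Surjective φ.toLinearMap :=
    (LinearMap.injective_iff_surjective_of_finrank_eq_finrank
      (by rw [hA, BiCliffAlg.finrank_eq])).1 hinj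
  exact ⟨AlgEquiv.ofBijective φ ⟨hinj, hsurj⟩, h1, h2, h3, h4⟩

theorem exists_eq_adjoin (h : IsBiCliff m n r s x₁ y₁ x₂ y₂) (hA : finrank F A = 16) (z : A) :
    ∃ r₀ ∈ Algebra.adjoin F {x₂, y₂}, ∃ r₁ ∈ Algebra.adjoin F {x₂, y₂},
      ∃ r₂ ∈ Algebra.adjoin F {x₂, y₂}, ∃ r₃ ∈ Algebra.adjoin F {x₂, y₂},
        z = r₀ + r₁ * x₁ + r₂ * y₁ + r₃ * (x₁ * y₁) := by
  obtain ⟨φ, h1, h2, h3, h4⟩ := h.exists_equiv hA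
  obtain ⟨z, rfl⟩ := φ.surjective z
  induction z using TensorProduct.induction_on with
  | zero =>
    have h0 := zero_mem (Algebra.adjoin F {x₂, y₂})
    exact ⟨0, h0, 0, h0, 0, h0, 0, h0, by simp⟩
  | tmul p q =>
    obtain ⟨a, b, c, d, rfl⟩ := CliffAlg.exists_eq _ _ p
    have hq := CliffAlg.algHom_mem_adjoin (φ.toAlgHom.comp Algebra.TensorProduct.includeRight) q
    simp only [AlgHom.comp_apply, Algebra.TensorProduct.includeRight_apply, AlgEquiv.toAlgHom_apply,
      h3, h4] at hq
    refine ⟨_, Subalgebra.smul_mem _ hq a, _, Subalgebra.smul_mem _ hq b, _,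
      Subalgebra.smul_mem _ hq c, _, Subalgebra.smul_mem _ hq d, ?_⟩
    simp only [← h1, ← h2, ← map_mul, ← map_smul, ← map_add]
    congr 1
    simp [TensorProduct.add_tmul, TensorProduct.smul_tmul']
  | add p q hp hq =>
    obtain ⟨a, ha, b, hb, c, hc, d, hd, hp⟩ := hp
    obtain ⟨a', ha', b', hb', c', hc', d', hd', hq⟩ := hq
    refine ⟨_, add_mem ha ha', _, add_mem hb hb', _, add_mem hc hc', _, add_mem hd hd', ?_⟩
    rw [map_add, hp, hq]
    simp only [add_mul]
    abel

theorem commute_left (h : IsBiCliff m n r s x₁ y₁ x₂ y₂) {z w : A}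
    (hz : z ∈ Algebra.adjoin F {x₁, y₁}) (hw : w ∈ Algebra.adjoin F {x₂, y₂}) : Commute z w :=
  IsCliff.commute_of_mem_adjoin (IsCliff.commute_of_mem_adjoin h.xx h.xy hz).symm
    (IsCliff.commute_of_mem_adjoin h.yx h.yy hz).symm hw

theorem exists_eq_of_commute (h : IsCliff m n x₁ y₁) (r₀ r₁ r₂ r₃ z : A)
    (h0x : Commute r₀ x₁) (h0y : Commute r₀ y₁)
    (h1x : Commute r₁ x₁) (h1y : Commute r₁ y₁) (h2x : Commute r₂ x₁) (h2y : Commute r₂ y₁)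
    (h3x : Commute r₃ x₁) (h3y : Commute r₃ y₁) (hx : Commute z x₁) (hy : Commute z y₁)
    (hz : z = r₀ + r₁ * x₁ + r₂ * y₁ + r₃ * (x₁ * y₁)) : z = r₀ := by
  have e (a : A) : a + a = 0 := by rw [← two_smul F, CharTwo.two_eq_zero, zero_smul]
  obtain ⟨h1, h2, h3⟩ := h.commutator h0x h0y h1x h1y h2x h2y h3x h3y hz
  rw [hx.eq, e] at h1 h3
  rw [hy.eq, e] at h2
  simp only [mul_zero, zero_mul, add_zero] at h3
  subst h3
  simp only [zero_mul, add_zero] at h1 h2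
  subst h1 h2
  simpa using hz

/-- The centralizer of the first pair is generated by the second pair. -/
theorem mem_adjoin_right (h : IsBiCliff m n r s x₁ y₁ x₂ y₂) (hA : finrank F A = 16) {z : A}
    (hx : Commute z x₁) (hy : Commute z y₁) : z ∈ Algebra.adjoin F {x₂, y₂} := by
  obtain ⟨r₀, h0, r₁, h1, r₂, h2, r₃, h3, hz⟩ := h.exists_eq_adjoin hA z
  have hxm : x₁ ∈ Algebra.adjoin F {x₁, y₁} := Algebra.subset_adjoin (by simp)
  have hym : y₁ ∈ Algebra.adjoin F {x₁, y₁} := Algebra.subset_adjoin (by simp)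
  rw [exists_eq_of_commute h.left r₀ r₁ r₂ r₃ z (h.commute_left hxm h0).symm
    (h.commute_left hym h0).symm (h.commute_left hxm h1).symm (h.commute_left hym h1).symm
    (h.commute_left hxm h2).symm (h.commute_left hym h2).symm (h.commute_left hxm h3).symm
    (h.commute_left hym h3).symm hx hy hz]
  exact h0

theorem exists_eq_smul_one (h : IsBiCliff m n r s x₁ y₁ x₂ y₂) (hA : finrank F A = 16) {z : A}
    (hx₁ : Commute z x₁) (hy₁ : Commute z y₁) (hx₂ : Commute z x₂) (hy₂ : Commute z y₂) :
    ∃ c : F, z = c • (1 : A) := by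
  obtain ⟨a, b, c, d, hz⟩ := h.right.exists_eq_of_mem_adjoin (h.mem_adjoin_right hA hx₁ hy₁)
  have hc (r : F) (z : A) : Commute (r • (1 : A)) z := (Commute.one_left z).smul_left r
  exact ⟨a, exists_eq_of_commute h.right (a • 1) (b • 1) (c • 1) (d • 1) z (hc _ _) (hc _ _)
    (hc _ _) (hc _ _) (hc _ _) (hc _ _) (hc _ _) (hc _ _) hx₂ hy₂
    (by simpa only [smul_one_mul] using hz)⟩

/-- A submodule containing all products of basis elements is everything. -/
theorem mem_of_forall_mem (h : IsBiCliff m n r s x₁ y₁ x₂ y₂) (hA : finrank F A = 16)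
    (S : Submodule F A) (hS : ∀ p ∈ ({1, x₁, y₁, x₁ * y₁} : Set A),
      ∀ q ∈ ({1, x₂, y₂, x₂ * y₂} : Set A), p * q ∈ S) (z : A) : z ∈ S := by
  have key (q : A) (hq : q ∈ ({1, x₂, y₂, x₂ * y₂} : Set A)) (p : A)
      (hp : p ∈ Algebra.adjoin F {x₁, y₁}) : p * q ∈ S := by
    obtain ⟨a, b, c, d, rfl⟩ := h.left.exists_eq_of_mem_adjoin hp
    simp only [add_mul, smul_mul_assoc]
    refine S.add_mem (S.add_mem (S.add_mem ?_ ?_) ?_) ?_ <;>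
    exact S.smul_mem _ (hS _ (by simp) _ hq)
  obtain ⟨r₀, h0, r₁, h1, r₂, h2, r₃, h3, rfl⟩ := h.swap.exists_eq_adjoin hA z
  refine S.add_mem (S.add_mem (S.add_mem ?_ ?_) ?_) ?_
  · simpa using key 1 (by simp) _ h0
  · exact key _ (by simp) _ h1
  · exact key _ (by simp) _ h2
  · exact key _ (by simp) _ h3

theorem adjoin_eq_top (h : IsBiCliff m n r s x₁ y₁ x₂ y₂) (hA : finrank F A = 16) :
    Algebra.adjoin F {x₁, y₁, x₂, y₂} = ⊤ := by
  refine Algebra.eq_top_iff.2 fun z ↦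
    h.mem_of_forall_mem hA (Subalgebra.toSubmodule (Algebra.adjoin F {x₁, y₁, x₂, y₂})) ?_ z
  have h1 : x₁ ∈ Algebra.adjoin F {x₁, y₁, x₂, y₂} := Algebra.subset_adjoin (by simp)
  have h2 : y₁ ∈ Algebra.adjoin F {x₁, y₁, x₂, y₂} := Algebra.subset_adjoin (by simp)
  have h3 : x₂ ∈ Algebra.adjoin F {x₁, y₁, x₂, y₂} := Algebra.subset_adjoin (by simp)
  have h4 : y₂ ∈ Algebra.adjoin F {x₁, y₁, x₂, y₂} := Algebra.subset_adjoin (by simp)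
  have h0 := one_mem (Algebra.adjoin F {x₁, y₁, x₂, y₂})
  rintro p (rfl | rfl | rfl | rfl) q (rfl | rfl | rfl | rfl) <;>
  rw [Subalgebra.mem_toSubmodule] <;> refine mul_mem ?_ ?_ <;>
  first | assumption | exact mul_mem ‹_› ‹_›

end IsBiCliff

end Biquaternion

section SimpleModules

variable {F : Type*} [Field F] {R : Type*} [Ring R] [Algebra F R] [IsSimpleRing R]
  [Module.Finite F R]

theorem isIsotypicOfType_of_isSimpleRing [IsArtinianRing R] (S : Submodule R R)
    [IsSimpleModule R S] (M : Type*) [AddCommGroup M] [Module R M] : IsIsotypicOfType R M S := by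
  intro m _
  obtain ⟨I, ⟨e⟩⟩ := IsSemisimpleRing.exists_linearEquiv_ideal_of_isSimpleModule R m
  have : IsSimpleModule R I := .congr e.symm
  obtain ⟨g⟩ := IsSimpleRing.isIsotypic R R S I
  exact ⟨e.trans g⟩

/-- Two modules of the same finite dimension over a finite-dimensional simple algebra are
isomorphic. -/
theorem exists_linearEquiv_of_isSimpleRing {V W : Type*} [AddCommGroup V] [Module F V]
    [Module R V] [IsScalarTower F R V] [Module.Finite F V] [AddCommGroup W] [Module F W]
    [Module R W] [IsScalarTower F R W] [Module.Finite F W] (h : finrank F V = finrank F W) :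
    Nonempty (V ≃ₗ[R] W) := by
  have : IsArtinianRing R := IsArtinianRing.of_finite F R
  obtain ⟨-, -, S, hS, -⟩ := (IsSimpleRing.isIsotypic R R).linearEquiv_fun
  have : Module.Finite R V := .of_restrictScalars_finite F R V
  have : Module.Finite R W := .of_restrictScalars_finite F R W
  obtain ⟨p, ⟨e⟩⟩ := (isIsotypicOfType_of_isSimpleRing S V).linearEquiv_fun
  obtain ⟨q, ⟨e'⟩⟩ := (isIsotypicOfType_of_isSimpleRing S W).linearEquiv_fun
  have hV := (e.restrictScalars F).finrank_eq
  have hW := (e'.restrictScalars F).finrank_eq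
  have : Module.Finite F S := .of_injective (S.subtype.restrictScalars F) Subtype.val_injective
  have hpos : 0 < finrank F S := by
    have := IsSimpleModule.nontrivial R S
    exact finrank_pos
  rw [finrank_pi_fintype, Finset.sum_const, Finset.card_univ, Fintype.card_fin, smul_eq_mul]
    at hV hW
  obtain rfl : p = q := Nat.eq_of_mul_eq_mul_right hpos (by omega)
  exact ⟨e.trans e'.symm⟩

theorem exists_linearEquiv_of_algHom {V W : Type*} [AddCommGroup V] [Module F V]
    [Module.Finite F V] [AddCommGroup W] [Module F W] [Module.Finite F W]
    (h : finrank F V = finrank F W) (ρ : R →ₐ[F] End F V) (ρ' : R →ₐ[F] End F W) :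
    ∃ e : V ≃ₗ[F] W, ∀ r v, e (ρ r v) = ρ' r (e v) := by
  let : Module R V := Module.compHom V ρ.toRingHom
  let : Module R W := Module.compHom W ρ'.toRingHom
  have : IsScalarTower F R V := ⟨fun c r v ↦ by
    change ρ (c • r) v = c • ρ r v
    rw [map_smul, LinearMap.smul_apply]⟩
  have : IsScalarTower F R W := ⟨fun c r v ↦ by
    change ρ' (c • r) v = c • ρ' r v
    rw [map_smul, LinearMap.smul_apply]⟩
  obtain ⟨e⟩ := exists_linearEquiv_of_isSimpleRing (F := F) (R := R) h
  exact ⟨e.restrictScalars F, fun r v ↦ e.map_smul r v⟩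

end SimpleModules

section RightMultiplication

variable {F : Type*} [Field F] [CharP F 2]

theorem IsCliff.op {A : Type*} [Ring A] [Algebra F A] {m n : F} {x y : A}
    (h : IsCliff m n x y) : IsCliff m n (MulOpposite.op x) (MulOpposite.op y) where
  xx := congrArg MulOpposite.op h.xx
  yy := congrArg MulOpposite.op h.yy
  yx := congrArg MulOpposite.op h.swap.yx

theorem IsBiCliff.op {A : Type*} [Ring A] [Algebra F A] {m n r s : F} {x₁ y₁ x₂ y₂ : A}
    (h : IsBiCliff m n r s x₁ y₁ x₂ y₂) : IsBiCliff m n r s (MulOpposite.op x₁)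
      (MulOpposite.op y₁) (MulOpposite.op x₂) (MulOpposite.op y₂) where
  left := h.left.op
  right := h.right.op
  xx := congrArg MulOpposite.op h.xx.symm
  xy := congrArg MulOpposite.op h.xy.symm
  yx := congrArg MulOpposite.op h.yx.symm
  yy := congrArg MulOpposite.op h.yy.symm

theorem finrank_mulOpposite {A : Type*} [Ring A] [Algebra F A] :
    finrank F Aᵐᵒᵖ = finrank F A := (MulOpposite.opLinearEquiv F).finrank_eq.symm

instance (m n r s m' n' r' s' : F) :
    IsSimpleRing (BiCliffAlg F m n r s ⊗[F] BiCliffAlg F m' n' r' s') := by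
  have h : IsSimpleRing
    (BiCliffAlg F m n r s ⊗[F] CliffAlg F m' n' ⊗[F] CliffAlg F r' s') := inferInstance
  let e := Algebra.TensorProduct.assoc F F F (BiCliffAlg F m n r s)
    (CliffAlg F m' n') (CliffAlg F r' s')
  exact IsSimpleRing.of_ringEquiv e.toRingEquiv h

variable {A : Type*} [Ring A] [Algebra F A] {m n r s m' n' r' s' : F} {x₁ y₁ x₂ y₂ : A}

theorem IsBiCliff.isSimpleRing (h : IsBiCliff m n r s x₁ y₁ x₂ y₂) (hA : finrank F A = 16) :
    IsSimpleRing A := by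
  obtain ⟨φ, -⟩ := h.exists_equiv hA
  exact IsSimpleRing.of_ringEquiv φ.toRingEquiv inferInstance

theorem IsBiCliff.isSimpleRing_tensor_op (h : IsBiCliff m n r s x₁ y₁ x₂ y₂)
    (hA : finrank F A = 16) : IsSimpleRing (A ⊗[F] Aᵐᵒᵖ) := by
  obtain ⟨φ, -⟩ := h.exists_equiv hA
  obtain ⟨ψ, -⟩ := h.op.exists_equiv (finrank_mulOpposite.trans hA)
  exact IsSimpleRing.of_ringEquiv (Algebra.TensorProduct.congr φ ψ).toRingEquiv inferInstance

/-- **Skolem–Noether** for biquaternion algebras. -/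
theorem IsBiCliff.exists_conj (h : IsBiCliff m n r s x₁ y₁ x₂ y₂) (hA : finrank F A = 16)
    (θ : A →ₐ[F] A) : ∃ f : Aˣ, ∀ z, z * f = f * θ z := by
  have : Module.Finite F A := Module.finite_of_finrank_pos (by omega)
  have := h.isSimpleRing_tensor_op hA
  obtain ⟨e, he⟩ := exists_linearEquiv_of_algHom (F := F) (R := A ⊗[F] Aᵐᵒᵖ) (V := A) (W := A) rfl
    (AlgHom.mulLeftRight F A)
    ((AlgHom.mulLeftRight F A).comp (Algebra.TensorProduct.map (AlgHom.id F A) (AlgHom.op θ)))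
  have key (a b z : A) : e (a * z * b) = a * e z * θ b := by
    simpa using he (a ⊗ₜ MulOpposite.op b) z
  obtain ⟨z, hz⟩ := e.surjective 1
  have h1 : z * e 1 = 1 := by simpa [hz] using (key z 1 1).symm
  have h2 : e 1 * θ z = 1 := by simpa [hz] using (key 1 z 1).symm
  have h3 : e 1 * z = 1 := by
    rw [← left_inv_eq_right_inv h1 h2] at h2
    exact h2
  refine ⟨⟨e 1, z, h3, h1⟩, fun w ↦ ?_⟩
  have h4 := key w 1 1
  have h5 := key 1 w 1
  simp only [mul_one, map_one, one_mul] at h4 h5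
  rw [← h4, ← h5]

/-- If the tensor product of a biquaternion algebra `A` with another one is a matrix algebra of
degree `16`, then `A` contains Clifford generators of the other one. -/
theorem exists_isBiCliff_of_split {T : Type*} [Ring T] [Algebra F T] [Module.Finite F A]
    [IsSimpleRing A] (hA : finrank F A = 16) (ι : A →ₐ[F] T)
    {x₃ y₃ x₄ y₄ : T} (h : IsBiCliff m n r s x₃ y₃ x₄ y₄)
    (hx₃ : ∀ a, Commute (ι a) x₃) (hy₃ : ∀ a, Commute (ι a) y₃)
    (hx₄ : ∀ a, Commute (ι a) x₄) (hy₄ : ∀ a, Commute (ι a) y₄)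
    (ρ : T →ₐ[F] Matrix (Fin 16) (Fin 16) F) :
    ∃ x₃ y₃ x₄ y₄ : A, IsBiCliff m n r s x₃ y₃ x₄ y₄ := by
  let ρ' : T →ₐ[F] End F (Fin 16 → F) := (Matrix.toLinAlgEquiv').toAlgHom.comp ρ
  obtain ⟨e, he⟩ := exists_linearEquiv_of_algHom (F := F) (R := A) (V := Fin 16 → F) (W := A)
    (by rw [finrank_fin_fun, hA]) (ρ'.comp ι) (Algebra.lmul F A)
  simp only [AlgHom.comp_apply, Algebra.coe_lmul_eq_mul, LinearMap.mul_apply'] at he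
  let c (t : T) : A := e (ρ' t (e.symm 1))
  have hc (t : T) (ht : ∀ a, Commute (ι a) t) (z : A) : e (ρ' t (e.symm z)) = z * c t := by
    have h1 : ρ' (ι z) (e.symm 1) = e.symm z := by
      rw [← e.injective.eq_iff, he, e.apply_symm_apply, e.apply_symm_apply, mul_one]
    rw [← h1, ← Module.End.mul_apply, ← map_mul, ← (ht z).eq, map_mul, Module.End.mul_apply, he]
  have hmul (t t' : T) (ht : ∀ a, Commute (ι a) t) : c (t * t') = c t' * c t := by
    change e (ρ' (t * t') _) = _
    rw [map_mul, Module.End.mul_apply, ← hc t ht, e.symm_apply_apply]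
  have hone : c 1 = 1 := by simp [c]
  have hadd (t t' : T) : c (t + t') = c t + c t' := by simp [c]
  have hsmul (a : F) (t : T) : c (a • t) = a • c t := by simp [c]
  refine ⟨c x₃, c y₃, c x₄, c y₄, ⟨?_, ?_, ?_⟩, ⟨?_, ?_, ?_⟩, ?_, ?_, ?_, ?_⟩
  · rw [← hmul _ _ hx₃, h.left.xx, hsmul, hone]
  · rw [← hmul _ _ hy₃, h.left.yy, hsmul, hone]
  · rw [← hmul _ _ hx₃, ← hmul _ _ hy₃, h.left.swap.yx, hadd, hone]
  · rw [← hmul _ _ hx₄, h.right.xx, hsmul, hone]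
  · rw [← hmul _ _ hy₄, h.right.yy, hsmul, hone]
  · rw [← hmul _ _ hx₄, ← hmul _ _ hy₄, h.right.swap.yx, hadd, hone]
  · rw [← hmul _ _ hx₃, ← hmul _ _ hx₄, h.xx]
  · rw [← hmul _ _ hx₄, ← hmul _ _ hy₃, h.xy]
  · rw [← hmul _ _ hx₃, ← hmul _ _ hy₄, h.yx]
  · rw [← hmul _ _ hy₃, ← hmul _ _ hy₄, h.yy]

end RightMultiplication

section Split

variable {F : Type*} [Field F] [CharP F 2]

theorem CliffAlg.nonempty_algEquiv {A : Type*} [Ring A] [Algebra F A] [Nontrivial A]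
    {m n m' n' : F} {x y x' y' : A} (h : IsCliff m n x y) (h' : IsCliff m' n' x' y')
    (hx : x' ∈ Algebra.adjoin F {x, y}) (hy : y' ∈ Algebra.adjoin F {x, y}) :
    Nonempty (CliffAlg F m n ≃ₐ[F] CliffAlg F m' n') := by
  obtain ⟨φ, rfl, rfl⟩ := CliffAlg.exists_lift h
  have hφ : Function.Injective φ := φ.toRingHom.injective
  have hr (z) (hz : z ∈ Algebra.adjoin F {φ (CliffAlg.x m n), φ (CliffAlg.y m n)}) :
      ∃ w, φ w = z := by
    have : z ∈ φ.range := by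
      refine Algebra.adjoin_le ?_ hz
      rintro _ (rfl | rfl) <;> exact ⟨_, rfl⟩
    exact this
  obtain ⟨p, rfl⟩ := hr _ hx
  obtain ⟨q, rfl⟩ := hr _ hy
  have hpq : IsCliff m' n' p q := ⟨hφ (by simpa using h'.xx), hφ (by simpa using h'.yy),
    hφ (by simpa using h'.yx)⟩
  obtain ⟨ψ, -⟩ := CliffAlg.exists_lift hpq
  have hψ : Function.Injective ψ := ψ.toRingHom.injective
  refine ⟨(AlgEquiv.ofBijective ψ ⟨hψ, ?_⟩).symm⟩
  exact (LinearMap.injective_iff_surjective_of_finrank_eq_finrank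
    (f := ψ.toLinearMap) (by rw [CliffAlg.finrank_eq, CliffAlg.finrank_eq])).1 hψ

theorem IsBiCliff.finrank_eq {A : Type*} [Ring A] [Algebra F A] [Nontrivial A] {m n r s : F}
    {x₁ y₁ x₂ y₂ : A} (h : IsBiCliff m n r s x₁ y₁ x₂ y₂)
    (htop : Algebra.adjoin F {x₁, y₁, x₂, y₂} = ⊤) : finrank F A = 16 := by
  obtain ⟨φ, h1, h2, h3, h4⟩ := h.exists_lift
  have hφ : Function.Injective φ := φ.toRingHom.injective
  have hr : φ.range = ⊤ := by
    rw [← top_le_iff, ← htop]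
    refine Algebra.adjoin_le ?_
    rintro _ (rfl | rfl | rfl | rfl)
    exacts [⟨_, h1⟩, ⟨_, h2⟩, ⟨_, h3⟩, ⟨_, h4⟩]
  rw [← BiCliffAlg.finrank_eq m n r s]
  exact (LinearEquiv.ofBijective φ.toLinearMap ⟨hφ, AlgHom.range_eq_top φ |>.1 hr⟩).finrank_eq.symm

open CliffAlg in
/-- If a biquaternion algebra contains Clifford generators of two biquaternion algebras, then the
tensor product of these is split. -/
theorem IsBiCliff.nonempty_algEquiv_matrix {A : Type*} [Ring A] [Algebra F A]
    {m n r s m' n' r' s' : F} {x₁ y₁ x₂ y₂ x₃ y₃ x₄ y₄ : A} (h : IsBiCliff m n r s x₁ y₁ x₂ y₂)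
    (h' : IsBiCliff m' n' r' s' x₃ y₃ x₄ y₄) (hA : finrank F A = 16) :
    Nonempty ((((CliffAlg F m n ⊗[F] CliffAlg F r s) ⊗[F] CliffAlg F m' n') ⊗[F]
      CliffAlg F r' s') ≃ₐ[F] Matrix (Fin 16) (Fin 16) F) := by
  have : Module.Finite F A := Module.finite_of_finrank_pos (by omega)
  obtain ⟨φ, -⟩ := h.exists_lift
  obtain ⟨ψ, -⟩ := h'.op.exists_lift
  let ρ : BiCliffAlg F m n r s ⊗[F] BiCliffAlg F m' n' r' s' →ₐ[F] End F A :=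
    (AlgHom.mulLeftRight F A).comp (Algebra.TensorProduct.map φ ψ)
  have : Nontrivial A := Module.nontrivial_of_finrank_pos (R := F) (by omega)
  have hρ : Function.Injective ρ := ρ.toRingHom.injective
  have hρ' : Function.Surjective ρ :=
    (LinearMap.injective_iff_surjective_of_finrank_eq_finrank (f := ρ.toLinearMap) (by
      rw [finrank_tensorProduct, BiCliffAlg.finrank_eq, BiCliffAlg.finrank_eq,
        finrank_linearMap, hA])).1 hρ
  exact ⟨(Algebra.TensorProduct.assoc F F F (BiCliffAlg F m n r s) (CliffAlg F m' n')
    (CliffAlg F r' s')).trans <| (AlgEquiv.ofBijective ρ ⟨hρ, hρ'⟩).trans <|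
      LinearMap.toMatrixAlgEquiv (finBasisOfFinrankEq F A hA)⟩

theorem CliffAlg.map_cliffSlot {K : Type*} [Field K] [Algebra K F] (m n : K) :
    algebraMap K F (cliffSlot m n) = cliffSlot (algebraMap K F m) (algebraMap K F n) := by
  have h (z : K) : algebraMap K F z = 0 ↔ z = 0 := map_eq_zero _
  by_cases hm : m = 0 <;> by_cases hn : n = 0 <;> simp [cliffSlot, h, hm, hn]

/-- Quaternion algebras that descend, together with a splitting of their tensor product, to an
extension of `k` of transcendence degree at most five. -/
def HasSmallDescent (k : Type*) {F : Type*} [Field k] [Field F] [Algebra k F] (a b : Fin 4 → F) :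
    Prop :=
  ∃ L : IntermediateField k F, trdeg k L ≤ 5 ∧
    ∃ a' b' : Fin 4 → L, (∀ i, b' i ≠ 0) ∧
      (∀ i, Nonempty (QuatAlg F (a' i : F) (b' i : F) ≃ₐ[F] QuatAlg F (a i) (b i))) ∧
      Nonempty
        ((((QuatAlg L (a' 0) (b' 0) ⊗[L] QuatAlg L (a' 1) (b' 1)) ⊗[L]
            QuatAlg L (a' 2) (b' 2)) ⊗[L] QuatAlg L (a' 3) (b' 3)) ≃ₐ[L]
          Matrix (Fin 16) (Fin 16) L)

theorem hasSmallDescent_of_isBiCliff {k : Type*} [Field k] [Algebra k F] {a b : Fin 4 → F}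
    {A : Type*} [Ring A] [Algebra F A] [Nontrivial A] (L : IntermediateField k F)
    (hL : trdeg k L ≤ 5) {M N : Fin 4 → L} {x₁ y₁ x₂ y₂ x₃ y₃ x₄ y₄ : A}
    (h : IsBiCliff (M 0 : F) (N 0 : F) (M 1 : F) (N 1 : F) x₁ y₁ x₂ y₂)
    (h' : IsBiCliff (M 2 : F) (N 2 : F) (M 3 : F) (N 3 : F) x₃ y₃ x₄ y₄)
    (hx₃ : x₃ ∈ Algebra.adjoin L {x₁, y₁, x₂, y₂}) (hy₃ : y₃ ∈ Algebra.adjoin L {x₁, y₁, x₂, y₂})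
    (hx₄ : x₄ ∈ Algebra.adjoin L {x₁, y₁, x₂, y₂}) (hy₄ : y₄ ∈ Algebra.adjoin L {x₁, y₁, x₂, y₂})
    (e : ∀ i, Nonempty (CliffAlg F (M i : F) (N i : F) ≃ₐ[F] QuatAlg F (a i) (b i))) :
    HasSmallDescent k a b := by
  have : CharP L 2 := (algebraMap L F).charP (algebraMap L F).injective 2
  refine ⟨L, hL, fun i ↦ M i * N i, fun i ↦ cliffSlot (M i) (N i),
    fun i ↦ cliffSlot_ne_zero _ _, fun i ↦ ?_, ?_⟩
  · have h1 := e i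
    have h2 := CliffAlg.map_cliffSlot (F := F) (M i) (N i)
    change ((cliffSlot (M i) (N i) : L) : F) = cliffSlot (M i : F) (N i : F) at h2
    rwa [h2]
  set B := Algebra.adjoin L {x₁, y₁, x₂, y₂} with hB
  have hsub : ({x₁, y₁, x₂, y₂} : Set A) ⊆ B := Algebra.subset_adjoin
  have hsm (c : L) (z : A) : (c : F) • z = c • z := rfl
  have hx₁ : x₁ ∈ B := hsub (by simp)
  have hy₁ : y₁ ∈ B := hsub (by simp)
  have hx₂ : x₂ ∈ B := hsub (by simp)
  have hy₂ : y₂ ∈ B := hsub (by simp)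
  have desc {m n r s : L} {p q z w : A} (hp : p ∈ B) (hq : q ∈ B) (hz : z ∈ B) (hw : w ∈ B)
      (h : IsBiCliff (m : F) (n : F) (r : F) (s : F) p q z w) :
      IsBiCliff (A := B) m n r s ⟨p, hp⟩ ⟨q, hq⟩ ⟨z, hz⟩ ⟨w, hw⟩ :=
    ⟨⟨Subtype.ext h.left.xx, Subtype.ext h.left.yy, Subtype.ext h.left.yx⟩,
      ⟨Subtype.ext h.right.xx, Subtype.ext h.right.yy, Subtype.ext h.right.yx⟩,
      Subtype.ext h.xx, Subtype.ext h.xy, Subtype.ext h.yx, Subtype.ext h.yy⟩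
  have hd := desc hx₁ hy₁ hx₂ hy₂ h
  refine hd.nonempty_algEquiv_matrix (desc hx₃ hy₃ hx₄ hy₄ h') (hd.finrank_eq ?_)
  refine Eq.trans (congrArg _ ?_)
    (Algebra.adjoin_adjoin_coe_preimage (R := L) (s := ({x₁, y₁, x₂, y₂} : Set A)))
  ext z
  exact or_congr Subtype.ext_iff (or_congr Subtype.ext_iff (or_congr Subtype.ext_iff
    Subtype.ext_iff))

end Split

section Involution

variable {F : Type*} [Field F] [CharP F 2] {A : Type*} [Ring A] [Algebra F A]

/-- A linear involution fixing the given Clifford generators. -/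
structure IsInvolution (σ : A →ₗ[F] A) (x₁ y₁ x₂ y₂ : A) : Prop where
  mul : ∀ z w, σ (z * w) = σ w * σ z
  invol : ∀ z, σ (σ z) = z
  one : σ 1 = 1
  x₁ : σ x₁ = x₁
  y₁ : σ y₁ = y₁
  x₂ : σ x₂ = x₂
  y₂ : σ y₂ = y₂

theorem IsInvolution.translate {σ : A →ₗ[F] A} {x₁ y₁ x₂ y₂ : A}
    (h : IsInvolution σ x₁ y₁ x₂ y₂) (a b c d : F) :
    IsInvolution σ (x₁ + a • (1 : A)) (y₁ + b • (1 : A)) (x₂ + c • (1 : A))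
      (y₂ + d • (1 : A)) where
  mul := h.mul
  invol := h.invol
  one := h.one
  x₁ := by rw [map_add, map_smul, h.one, h.x₁]
  y₁ := by rw [map_add, map_smul, h.one, h.y₁]
  x₂ := by rw [map_add, map_smul, h.one, h.x₂]
  y₂ := by rw [map_add, map_smul, h.one, h.y₂]

/-- The alternating elements for the involution fixing the given Clifford generators. -/
def altSpan (F : Type*) [Field F] {A : Type*} [Ring A] [Algebra F A] (x₁ y₁ x₂ y₂ : A) :
    Submodule F A :=
  Submodule.span F {1, x₁ * y₁ + x₂ * y₂, x₁, y₁, x₂, y₂}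

theorem mem_altSpan {x₁ y₁ x₂ y₂ z : A} : z ∈ altSpan F x₁ y₁ x₂ y₂ ↔ ∃ a b c d e g : F,
    z = a • (1 : A) + b • (x₁ * y₁ + x₂ * y₂) + c • x₁ + d • y₁ + e • x₂ + g • y₂ := by
  simp only [altSpan, Submodule.mem_span_insert, Submodule.mem_span_singleton]
  constructor
  · rintro ⟨a, _, ⟨b, _, ⟨c, _, ⟨d, _, ⟨e, _, ⟨g, rfl⟩, rfl⟩, rfl⟩, rfl⟩, rfl⟩, rfl⟩
    exact ⟨a, b, c, d, e, g, by abel⟩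
  · rintro ⟨a, b, c, d, e, g, rfl⟩
    exact ⟨a, _, ⟨b, _, ⟨c, _, ⟨d, _, ⟨e, _, ⟨g, rfl⟩, rfl⟩, rfl⟩, rfl⟩, rfl⟩, by abel⟩

variable {m n r s : F} {x₁ y₁ x₂ y₂ : A}

theorem IsBiCliff.exists_isInvolution (h : IsBiCliff m n r s x₁ y₁ x₂ y₂)
    (hA : finrank F A = 16) : ∃ σ : A →ₗ[F] A, IsInvolution σ x₁ y₁ x₂ y₂ := by
  obtain ⟨φ, a1, a2, a3, a4⟩ := h.exists_equiv hA
  obtain ⟨ψ, b1, b2, b3, b4⟩ := h.op.exists_equiv (finrank_mulOpposite.trans hA)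
  let σ : A →ₗ[F] A := ((MulOpposite.opLinearEquiv F).symm.toLinearMap ∘ₗ ψ.toLinearMap) ∘ₗ
    φ.symm.toLinearMap
  have hσ (z) : σ z = MulOpposite.unop (ψ (φ.symm z)) := rfl
  have mul (z w) : σ (z * w) = σ w * σ z := by simp [hσ]
  have one : σ 1 = 1 := by simp [hσ]
  have hx₁ : σ x₁ = x₁ := by rw [hσ, ← a1, φ.symm_apply_apply, b1, a1, MulOpposite.unop_op]
  have hy₁ : σ y₁ = y₁ := by rw [hσ, ← a2, φ.symm_apply_apply, b2, a2, MulOpposite.unop_op]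
  have hx₂ : σ x₂ = x₂ := by rw [hσ, ← a3, φ.symm_apply_apply, b3, a3, MulOpposite.unop_op]
  have hy₂ : σ y₂ = y₂ := by rw [hσ, ← a4, φ.symm_apply_apply, b4, a4, MulOpposite.unop_op]
  refine ⟨σ, mul, fun z ↦ ?_, one, hx₁, hy₁, hx₂, hy₂⟩
  refine h.mem_of_forall_mem hA (LinearMap.eqLocus (σ ∘ₗ σ) LinearMap.id) ?_ z
  rintro _ (rfl | rfl | rfl | rfl) _ (rfl | rfl | rfl | rfl) <;>
  simp [mul, one, hx₁, hx₂, hy₁, hy₂]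

theorem IsBiCliff.add_involution_mem (h : IsBiCliff m n r s x₁ y₁ x₂ y₂)
    (hA : finrank F A = 16) {σ : A →ₗ[F] A} (hσ : IsInvolution σ x₁ y₁ x₂ y₂) (z : A) :
    z + σ z ∈ altSpan F x₁ y₁ x₂ y₂ := by
  have h2 (w : A) : w + w = 0 := by rw [← two_smul F, CharTwo.two_eq_zero, zero_smul]
  have h3 (u v : A) : u + (v + u) = v := by rw [add_comm, add_assoc, h2, add_zero]
  have h5 (u : A) : u + (1 + x₁ * y₁ + (x₂ * y₂ + u)) = 1 + (x₁ * y₁ + x₂ * y₂) := by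
    rw [add_assoc 1, ← add_assoc (x₁ * y₁), ← add_assoc 1, h3]
  have m1 : (1 : A) ∈ altSpan F x₁ y₁ x₂ y₂ := Submodule.subset_span (by simp)
  have m2 : x₁ * y₁ + x₂ * y₂ ∈ altSpan F x₁ y₁ x₂ y₂ := Submodule.subset_span (by simp)
  have m3 : x₁ ∈ altSpan F x₁ y₁ x₂ y₂ := Submodule.subset_span (by simp)
  have m4 : y₁ ∈ altSpan F x₁ y₁ x₂ y₂ := Submodule.subset_span (by simp)
  have m5 : x₂ ∈ altSpan F x₁ y₁ x₂ y₂ := Submodule.subset_span (by simp)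
  have m6 : y₂ ∈ altSpan F x₁ y₁ x₂ y₂ := Submodule.subset_span (by simp)
  have h12 := (altSpan F x₁ y₁ x₂ y₂).add_mem m1 m2
  refine h.mem_of_forall_mem hA ((altSpan F x₁ y₁ x₂ y₂).comap (LinearMap.id + σ)) ?_ z
  rintro _ (rfl | rfl | rfl | rfl) _ (rfl | rfl | rfl | rfl) <;>
  simp only [Submodule.mem_comap, LinearMap.add_apply, LinearMap.id_apply, hσ.mul, hσ.one, hσ.x₁,
    hσ.y₁, hσ.x₂, hσ.y₂, mul_one, one_mul, h.xx, h.xy, h.yx, h.yy, h.xx', h.xy', h.yx', h.yy',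
    h.left.yx, h.right.yx, h.left.yx', mul_add, add_mul, mul_assoc, h2, h3, h5, zero_mem,
    m1, m3, m4, m5, m6, h12]

end Involution

section Link

variable {F : Type*} [Field F] [CharP F 2] {A : Type*} [Ring A] [Algebra F A]

/-- The unit `f` links the involution `σ` to the involution which fixes the given generators. -/
structure IsLink (σ : A →ₗ[F] A) (x₃ y₃ x₄ y₄ f : A) : Prop where
  isUnit : IsUnit f
  symm : σ f = f
  x₃ : x₃ * f = f * σ x₃
  y₃ : y₃ * f = f * σ y₃
  x₄ : x₄ * f = f * σ x₄
  y₄ : y₄ * f = f * σ y₄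

variable {m n r s m' n' r' s' : F} {x₁ y₁ x₂ y₂ x₃ y₃ x₄ y₄ f : A} {σ τ : A →ₗ[F] A}

theorem IsBiCliff.exists_isLink [Nontrivial A] (h : IsBiCliff m n r s x₁ y₁ x₂ y₂)
    (hA : finrank F A = 16) (hσ : IsInvolution σ x₁ y₁ x₂ y₂) (hτ : IsInvolution τ x₃ y₃ x₄ y₄) :
    ∃ f, IsLink σ x₃ y₃ x₄ y₄ f := by
  obtain ⟨f, hf⟩ := h.exists_conj hA
    (AlgHom.ofLinearMap (σ ∘ₗ τ) (by simp [hσ.one, hτ.one]) (by simp [hσ.mul, hτ.mul]))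
  simp only [AlgHom.ofLinearMap_apply, LinearMap.comp_apply] at hf
  have key (z : A) : τ z * f = f * σ z := by rw [hf, hτ.invol]
  have key' (z : A) : σ f * σ z = τ z * σ f := by
    have := congrArg σ (hf z)
    rwa [hσ.mul, hσ.mul, hσ.invol] at this
  have comm (z : A) : Commute (↑f⁻¹ * σ f) (σ z) := by
    rw [commute_iff_eq, mul_assoc, key', ← mul_assoc, ← mul_assoc]
    congr 1
    rw [Units.inv_mul_eq_iff_eq_mul, ← mul_assoc, ← key, Units.mul_inv_cancel_right]
  obtain ⟨c, hc⟩ := h.exists_eq_smul_one hA (hσ.x₁ ▸ comm x₁) (hσ.y₁ ▸ comm y₁) (hσ.x₂ ▸ comm x₂)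
    (hσ.y₂ ▸ comm y₂)
  rw [Units.inv_mul_eq_iff_eq_mul, mul_smul_comm, mul_one] at hc
  have hc2 : c * c = 1 := by
    have h1 := hσ.invol f
    rw [hc, map_smul, hc, smul_smul] at h1
    by_contra h2
    have h3 : (c * c - 1) • (f : A) = 0 := by rw [sub_smul, h1, one_smul, sub_self]
    rw [smul_eq_zero] at h3
    exact h3.elim (fun h ↦ h2 (sub_eq_zero.1 h)) f.ne_zero
  obtain rfl : c = 1 := by
    have h2 : (2 : F) = 0 := CharTwo.two_eq_zero
    have : (c - 1) * (c - 1) = 0 := by grind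
    exact sub_eq_zero.1 (mul_self_eq_zero.1 this)
  refine ⟨f, f.isUnit, by rw [hc, one_smul], ?_, ?_, ?_, ?_⟩
  · rw [hf, hτ.x₁]
  · rw [hf, hτ.y₁]
  · rw [hf, hτ.x₂]
  · rw [hf, hτ.y₂]

namespace IsLink

theorem involution_mul (hf : IsLink σ x₃ y₃ x₄ y₄ f) (h' : IsBiCliff m' n' r' s' x₃ y₃ x₄ y₄)
    (hA : finrank F A = 16) (hσ : IsInvolution σ x₁ y₁ x₂ y₂) (hτ : IsInvolution τ x₃ y₃ x₄ y₄)
    (z : A) : τ z * f = f * σ z := by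
  have hm {p q : A} (hp : τ p * f = f * σ p) (hq : τ q * f = f * σ q) :
      τ (p * q) * f = f * σ (p * q) := by
    rw [hτ.mul, hσ.mul, mul_assoc, hp, ← mul_assoc, hq, mul_assoc]
  have h1 : τ 1 * f = f * σ 1 := by rw [hσ.one, hτ.one, mul_one, one_mul]
  have hx₃ : τ x₃ * f = f * σ x₃ := by rw [hτ.x₁, hf.x₃]
  have hy₃ : τ y₃ * f = f * σ y₃ := by rw [hτ.y₁, hf.y₃]
  have hx₄ : τ x₄ * f = f * σ x₄ := by rw [hτ.x₂, hf.x₄]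
  have hy₄ : τ y₄ * f = f * σ y₄ := by rw [hτ.y₂, hf.y₄]
  refine h'.mem_of_forall_mem hA
    (LinearMap.eqLocus (LinearMap.mulRight F f ∘ₗ τ) (LinearMap.mulLeft F f ∘ₗ σ)) ?_ z
  rintro _ (rfl | rfl | rfl | rfl) _ (rfl | rfl | rfl | rfl) <;>
  · refine hm ?_ ?_ <;> first | assumption | exact hm ‹_› ‹_›

theorem mul_mem_altSpan_of_commute (hf : IsLink σ x₃ y₃ x₄ y₄ f)
    (h : IsBiCliff m n r s x₁ y₁ x₂ y₂) (hA : finrank F A = 16) (hσ : IsInvolution σ x₁ y₁ x₂ y₂)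
    {p q z : A} (hpq : IsCliff m' n' p q) (hp : p * f = f * σ p) (hq : q * f = f * σ q)
    (hz : z * f = f * σ z) (hzp : p * z = z * p) (hzq : q * z = z * q) :
    z * f ∈ altSpan F x₁ y₁ x₂ y₂ := by
  have h1 := h.add_involution_mem hA hσ (z * (p * q) * f)
  rw [hσ.mul, hσ.mul, hσ.mul, hf.symm, ← mul_assoc f, ← mul_assoc f, ← hq, mul_assoc q, ← hp,
    mul_assoc q, mul_assoc p, ← hz, ← mul_assoc p, ← mul_assoc q, ← mul_assoc q, mul_assoc q, hzp,
    ← mul_assoc q, hzq, mul_assoc z q, ← add_mul, ← mul_add, hpq.swap.yx, add_assoc,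
    ← two_smul F (q * p), CharTwo.two_eq_zero, zero_smul, add_zero, mul_one] at h1
  exact h1

theorem mem_altSpan (hf : IsLink σ x₃ y₃ x₄ y₄ f) (h : IsBiCliff m n r s x₁ y₁ x₂ y₂)
    (h' : IsCliff m' n' x₃ y₃) (hA : finrank F A = 16) (hσ : IsInvolution σ x₁ y₁ x₂ y₂) :
    f ∈ altSpan F x₁ y₁ x₂ y₂ := by
  simpa using hf.mul_mem_altSpan_of_commute h hA hσ (z := 1) h' hf.x₃ hf.y₃
    (by rw [hσ.one, one_mul, mul_one]) (by simp) (by simp)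

theorem mul_mem_altSpan (hf : IsLink σ x₃ y₃ x₄ y₄ f) (h : IsBiCliff m n r s x₁ y₁ x₂ y₂)
    (h' : IsBiCliff m' n' r' s' x₃ y₃ x₄ y₄) (hA : finrank F A = 16)
    (hσ : IsInvolution σ x₁ y₁ x₂ y₂) {z : A} (hz : z ∈ ({x₃, y₃, x₄, y₄} : Set A)) :
    z * f ∈ altSpan F x₁ y₁ x₂ y₂ := by
  obtain rfl | rfl | rfl | rfl := hz
  · exact hf.mul_mem_altSpan_of_commute h hA hσ h'.right hf.x₄ hf.y₄ hf.x₃ h'.xx h'.yx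
  · exact hf.mul_mem_altSpan_of_commute h hA hσ h'.right hf.x₄ hf.y₄ hf.y₃ h'.xy h'.yy
  · exact hf.mul_mem_altSpan_of_commute h hA hσ h'.left hf.x₃ hf.y₃ hf.x₄ h'.xx.symm h'.xy.symm
  · exact hf.mul_mem_altSpan_of_commute h hA hσ h'.left hf.x₃ hf.y₃ hf.y₄ h'.yx.symm h'.yy.symm

theorem conj (hf : IsLink σ x₃ y₃ x₄ y₄ f) (hσ : IsInvolution σ x₁ y₁ x₂ y₂) (g : Aˣ) :
    IsLink σ (g * x₃ * ↑g⁻¹) (g * y₃ * ↑g⁻¹) (g * x₄ * ↑g⁻¹) (g * y₄ * ↑g⁻¹) (g * f * σ g) := by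
  have h1 : σ g * σ ↑g⁻¹ = 1 := by rw [← hσ.mul, Units.inv_mul, hσ.one]
  have h2 : σ ↑g⁻¹ * σ g = 1 := by rw [← hσ.mul, Units.mul_inv, hσ.one]
  have key {z : A} (hz : z * f = f * σ z) :
      g * z * ↑g⁻¹ * (g * f * σ g) = g * f * σ g * σ (g * z * ↑g⁻¹) := by
    rw [hσ.mul, hσ.mul, ← mul_assoc (σ _) (σ _) (σ g), mul_assoc _ (σ g), ← mul_assoc (σ g),
      ← mul_assoc (σ g), h1, one_mul, mul_assoc _ _ (g * f * σ g), mul_assoc _ f, ← mul_assoc _ _ (f * _),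
      Units.inv_mul, one_mul, ← mul_assoc, mul_assoc _ z, hz]
    simp only [mul_assoc]
  refine ⟨(g.isUnit.mul hf.isUnit).mul ⟨⟨_, _, h1, h2⟩, rfl⟩, ?_, key hf.x₃, key hf.y₃, key hf.x₄,
    key hf.y₄⟩
  rw [hσ.mul, hσ.mul, hσ.invol, hf.symm, mul_assoc]

theorem smul (hf : IsLink σ x₃ y₃ x₄ y₄ f) {c : F} (hc : c ≠ 0) :
    IsLink σ x₃ y₃ x₄ y₄ (c • f) where
  isUnit := (isUnit_smul_iff (Units.mk0 c hc) f).2 hf.isUnit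
  symm := by rw [map_smul, hf.symm]
  x₃ := by rw [mul_smul_comm, hf.x₃, smul_mul_assoc]
  y₃ := by rw [mul_smul_comm, hf.y₃, smul_mul_assoc]
  x₄ := by rw [mul_smul_comm, hf.x₄, smul_mul_assoc]
  y₄ := by rw [mul_smul_comm, hf.y₄, smul_mul_assoc]

theorem translate (hf : IsLink σ x₃ y₃ x₄ y₄ f) (hσ : σ 1 = 1) (a b c d : F) :
    IsLink σ (x₃ + a • (1 : A)) (y₃ + b • (1 : A)) (x₄ + c • (1 : A)) (y₄ + d • (1 : A)) f := by
  have key {z : A} (a : F) (hz : z * f = f * σ z) :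
      (z + a • (1 : A)) * f = f * σ (z + a • (1 : A)) := by
    rw [map_add, map_smul, hσ, mul_add, add_mul, hz, smul_one_mul, mul_smul_one]
  exact ⟨hf.isUnit, hf.symm, key a hf.x₃, key b hf.y₃, key c hf.x₄, key d hf.y₄⟩

end IsLink

theorem IsBiCliff.conj (h : IsBiCliff m n r s x₁ y₁ x₂ y₂) (g : Aˣ) :
    IsBiCliff m n r s (g * x₁ * ↑g⁻¹) (g * y₁ * ↑g⁻¹) (g * x₂ * ↑g⁻¹) (g * y₂ * ↑g⁻¹) := by
  have h1 (c : F) : (g : A) * algebraMap F A c * ↑g⁻¹ = algebraMap F A c := by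
    rw [← Algebra.commutes, mul_assoc, Units.mul_inv, mul_one]
  exact h.map (AlgHom.mk (MulSemiringAction.toRingHom (ConjAct Aˣ) A (ConjAct.toConjAct g)) h1)

end Link

section Generic

variable {F : Type*} [Field F] {A : Type*} [Ring A] [Algebra F A]

/-- The span of `1` and the given generators. -/
def vecSpan (F : Type*) [Field F] {A : Type*} [Ring A] [Algebra F A] (x₁ y₁ x₂ y₂ : A) :
    Submodule F A :=
  Submodule.span F {1, x₁, y₁, x₂, y₂}

theorem mem_vecSpan {x₁ y₁ x₂ y₂ z : A} : z ∈ vecSpan F x₁ y₁ x₂ y₂ ↔ ∃ a c d e g : F,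
    z = a • (1 : A) + c • x₁ + d • y₁ + e • x₂ + g • y₂ := by
  simp only [vecSpan, Submodule.mem_span_insert, Submodule.mem_span_singleton]
  constructor
  · rintro ⟨a, _, ⟨c, _, ⟨d, _, ⟨e, _, ⟨g, rfl⟩, rfl⟩, rfl⟩, rfl⟩, rfl⟩
    exact ⟨a, c, d, e, g, by abel⟩
  · rintro ⟨a, c, d, e, g, rfl⟩
    exact ⟨a, _, ⟨c, _, ⟨d, _, ⟨e, _, ⟨g, rfl⟩, rfl⟩, rfl⟩, rfl⟩, by abel⟩

theorem finite_setOf_not_isUnit_sub [Module.Finite F A] (z : A) :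
    {c : F | ¬ IsUnit (algebraMap F A c - z)}.Finite := by
  refine (Module.End.finite_spectrum (Algebra.lmul F A z)).subset fun c hc hu ↦ hc ?_
  rw [spectrum.mem_resolventSet_iff, ← (Algebra.lmul F A).commutes, ← map_sub] at hu
  exact Algebra.lmul_isUnit_iff.1 hu

variable [CharP F 2] {m n r s m' n' r' s' : F} {x₁ y₁ x₂ y₂ x₃ y₃ x₄ y₄ f : A} {σ τ : A →ₗ[F] A}

theorem IsBiCliff.notMem_vecSpan [Nontrivial A] (h : IsBiCliff m n r s x₁ y₁ x₂ y₂) :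
    x₁ * y₁ + x₂ * y₂ ∉ vecSpan F x₁ y₁ x₂ y₂ := by
  rw [mem_vecSpan]
  rintro ⟨a, b, c, d, e, hq⟩
  have h2 : (2 : F) = 0 := CharTwo.two_eq_zero
  have e1 := congrArg (fun z ↦ x₁ * z + z * x₁) hq
  have e2 : x₁ * (x₁ * y₁ + x₂ * y₂) + (x₁ * y₁ + x₂ * y₂) * x₁ = (1 : F) • x₁ := by
    simp only [mul_add, add_mul, mul_assoc, h.left.xx, h.left.yx, h.left.xx', h.xx', h.yx, h.xx,
      mul_one]
    match_scalars <;> grind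
  have e3 : x₁ * (a • (1 : A) + b • x₁ + c • y₁ + d • x₂ + e • y₂) +
      (a • (1 : A) + b • x₁ + c • y₁ + d • x₂ + e • y₂) * x₁ = c • 1 := by
    simp only [mul_add, add_mul, smul_mul_assoc, mul_smul_comm, h.left.yx, h.yx, h.xx,
      mul_one, one_mul]
    match_scalars <;> grind
  simp only [e2, e3, one_smul] at e1
  have := h.left.yx
  rw [e1, mul_smul_one, smul_one_mul, right_eq_add] at this
  exact one_ne_zero this

theorem IsLink.exists_notMem_vecSpan [Infinite F] [Nontrivial A] (hf : IsLink σ x₃ y₃ x₄ y₄ f)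
    (h : IsBiCliff m n r s x₁ y₁ x₂ y₂) (h' : IsBiCliff m' n' r' s' x₃ y₃ x₄ y₄)
    (hA : finrank F A = 16) (hσ : IsInvolution σ x₁ y₁ x₂ y₂) :
    ∃ x₃ y₃ x₄ y₄ f : A, IsBiCliff m' n' r' s' x₃ y₃ x₄ y₄ ∧ IsLink σ x₃ y₃ x₄ y₄ f ∧
      f ∉ vecSpan F x₁ y₁ x₂ y₂ := by
  by_cases h0 : f ∈ vecSpan F x₁ y₁ x₂ y₂
  swap
  · exact ⟨_, _, _, _, f, h', hf, h0⟩
  have : Module.Finite F A := Module.finite_of_finrank_pos (by omega)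
  have h2 : (2 : F) = 0 := CharTwo.two_eq_zero
  obtain ⟨u, rfl⟩ := hf.isUnit
  set p := x₁ * y₁ * (x₂ * y₂) with hp
  set w : A := p * ↑u⁻¹ with hw
  have hwu : w * u = p := by rw [hw, Units.inv_mul_cancel_right]
  have hwu' : u * σ w = σ p := by
    rw [← hf.symm, ← hσ.mul, hwu]
  have hpp : p + σ p = (1 : F) • (1 : A) + (x₁ * y₁ + x₂ * y₂) := by
    simp only [hp, hσ.mul, hσ.x₁, hσ.x₂, hσ.y₁, hσ.y₂, h.left.yx, h.right.yx, mul_add, add_mul,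
      mul_one, one_mul, h.xx', h.yx', h.xy', h.yy', h.xx, h.yy, h.xy, h.yx, h.left.yx', mul_assoc]
    match_scalars <;> grind
  have hexp (c : F) : (algebraMap F A c - w) * u * σ (algebraMap F A c - w) =
      c ^ 2 • (u : A) + (c • (1 + (x₁ * y₁ + x₂ * y₂)) + w * u * σ w) := by
    rw [map_sub, Algebra.algebraMap_eq_smul_one, map_smul, hσ.one, sub_mul, sub_mul, mul_sub,
      mul_sub, mul_smul_one, mul_smul_one, smul_one_mul, smul_mul_assoc, hwu, hwu',
      ← one_smul F (1 : A), ← hpp]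
    match_scalars <;> grind
  obtain ⟨c, hc, d, hd, hcd⟩ := (finite_setOf_not_isUnit_sub (F := F) w).infinite_compl.nontrivial
  simp only [Set.mem_compl_iff, Set.mem_ofPred_eq, not_not] at hc hd
  obtain ⟨g, hg⟩ := hc
  obtain ⟨g', hg'⟩ := hd
  by_cases h1 : g * u * σ g ∈ vecSpan F x₁ y₁ x₂ y₂
  swap
  · exact ⟨_, _, _, _, _, h'.conj g, hf.conj hσ g, h1⟩
  refine ⟨_, _, _, _, _, h'.conj g', hf.conj hσ g', fun h3 ↦ h.notMem_vecSpan ?_⟩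
  rw [hg, hexp, Submodule.add_mem_iff_right _ (Submodule.smul_mem _ _ h0)] at h1
  rw [hg', hexp, Submodule.add_mem_iff_right _ (Submodule.smul_mem _ _ h0)] at h3
  have h4 := Submodule.sub_mem _ h1 h3
  rw [add_sub_add_right_eq_sub, ← sub_smul, Submodule.smul_mem_iff _ (sub_ne_zero.2 hcd),
    Submodule.add_mem_iff_right] at h4
  · exact h4
  · exact Submodule.subset_span (by simp)

end Generic

section Standard

variable {F : Type*} [Field F] [CharP F 2] {A : Type*} [Ring A] [Algebra F A]
  {m n r s m' n' r' s' t t' : F} {x₁ y₁ x₂ y₂ x₃ y₃ x₄ y₄ f : A} {σ τ : A →ₗ[F] A}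

theorem IsBiCliff.mul_self_eq (h : IsBiCliff m n r s x₁ y₁ x₂ y₂) (a b c d e g : F) {z : A}
    (hz : z = a • (1 : A) + b • (x₁ * y₁ + x₂ * y₂) + c • x₁ + d • y₁ + e • x₂ + g • y₂) :
    z * z = b • z + (a ^ 2 + b * a + b ^ 2 * (m * n + r * s) + c ^ 2 * m + d ^ 2 * n + c * d +
      e ^ 2 * r + g ^ 2 * s + e * g) • (1 : A) := by
  have h2 : (2 : F) = 0 := CharTwo.two_eq_zero
  subst hz
  simp only [mul_add, add_mul, mul_assoc, smul_mul_assoc, mul_smul_comm, mul_one, one_mul,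
    h.left.xx, h.left.yy, h.left.yx, h.left.xx', h.left.yy', h.left.yx', h.right.xx, h.right.yy,
    h.right.yx, h.right.xx', h.right.yy', h.right.yx', h.xx, h.xy, h.yx, h.yy, h.xx', h.xy',
    h.yx', h.yy']
  match_scalars <;> grind

theorem IsBiCliff.commutator_eq (h : IsBiCliff m n r s x₁ y₁ x₂ y₂) (a b c d e g : F) {z : A}
    (hf : f = x₁ * y₁ + x₂ * y₂ + t • (1 : A))
    (hz : z = a • (1 : A) + b • (x₁ * y₁ + x₂ * y₂) + c • x₁ + d • y₁ + e • x₂ + g • y₂) :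
    f * z + z * f = c • x₁ + d • y₁ + e • x₂ + g • y₂ := by
  have h2 : (2 : F) = 0 := CharTwo.two_eq_zero
  subst hz hf
  simp only [mul_add, add_mul, mul_assoc, smul_mul_assoc, mul_smul_comm, mul_one, one_mul,
    h.left.xx, h.left.yy, h.left.yx, h.left.xx', h.left.yy', h.left.yx', h.right.xx, h.right.yy,
    h.right.yx, h.right.xx', h.right.yy', h.right.yx', h.xx, h.xy, h.yx, h.yy, h.xx', h.xy',
    h.yx', h.yy']
  match_scalars <;> grind

theorem IsBiCliff.mul_eq_mul_add (h : IsBiCliff m n r s x₁ y₁ x₂ y₂)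
    (hf : f = x₁ * y₁ + x₂ * y₂ + t • (1 : A)) {z : A}
    (hz : z ∈ Submodule.span F {x₁, y₁, x₂, y₂}) : f * z = z * f + z := by
  simp only [Submodule.mem_span_insert, Submodule.mem_span_singleton] at hz
  obtain ⟨c, _, ⟨d, _, ⟨e, _, ⟨g, rfl⟩, rfl⟩, rfl⟩, hz⟩ := hz
  have h1 := h.commutator_eq 0 0 c d e g hf (z := z) (by rw [hz]; module)
  have h3 (a : A) : a + a = 0 := by rw [← two_smul F, CharTwo.two_eq_zero, zero_smul]
  have h2 : c • x₁ + d • y₁ + e • x₂ + g • y₂ = z := by rw [hz]; abel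
  rw [h2] at h1
  calc f * z = z * f + (f * z + z * f) := by rw [add_left_comm, h3, add_zero]
    _ = z * f + z := by rw [h1]

/-- Normal form for an alternating element up to translations of the generators. -/
theorem exists_translate {a c d e g : F}
    (hf : f = a • (1 : A) + (1 : F) • (x₁ * y₁ + x₂ * y₂) + c • x₁ + d • y₁ + e • x₂ + g • y₂) :
    ∃ t : F, f = (x₁ + d • (1 : A)) * (y₁ + c • (1 : A)) +
      (x₂ + g • (1 : A)) * (y₂ + e • (1 : A)) + t • (1 : A) := by
  have h2 : (2 : F) = 0 := CharTwo.two_eq_zero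
  refine ⟨a + c * d + e * g, ?_⟩
  rw [hf]
  simp only [mul_add, add_mul, smul_mul_assoc, mul_smul_comm, mul_one, one_mul]
  match_scalars <;> grind

theorem IsCliff.nonempty_algEquiv_translate [Nontrivial A] (h : IsCliff m n x₁ y₁) (c d : F) :
    Nonempty (CliffAlg F m n ≃ₐ[F] CliffAlg F (m + c ^ 2) (n + d ^ 2)) := by
  refine CliffAlg.nonempty_algEquiv h (h.translate c d) ?_ ?_
  · exact add_mem (Algebra.subset_adjoin (by simp)) (Subalgebra.smul_mem _ (one_mem _) _)
  · exact add_mem (Algebra.subset_adjoin (by simp)) (Subalgebra.smul_mem _ (one_mem _) _)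

theorem IsLink.mem_altSpan_right [Nontrivial A] (hf : IsLink σ x₃ y₃ x₄ y₄ f)
    (h : IsBiCliff m n r s x₁ y₁ x₂ y₂) (h' : IsBiCliff m' n' r' s' x₃ y₃ x₄ y₄)
    (hA : finrank F A = 16) (hσ : IsInvolution σ x₁ y₁ x₂ y₂)
    (hff : f = x₁ * y₁ + x₂ * y₂ + t • (1 : A)) : ∃ a c d e g : F,
    f = a • (1 : A) + (1 : F) • (x₃ * y₃ + x₄ * y₄) + c • x₃ + d • y₃ + e • x₄ + g • y₄ := by
  obtain ⟨β, hsq⟩ : ∃ β : F, f * f = f + β • (1 : A) :=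
    ⟨_, (h.mul_self_eq t 1 0 0 0 0 (z := f) (by rw [hff]; module)).trans (by rw [one_smul])⟩
  obtain ⟨τ, hτ⟩ := h'.exists_isInvolution hA
  have hl := hf.involution_mul h' hA hσ hτ
  obtain ⟨u, hu⟩ := hf.isUnit
  have hτf : τ u = u := by
    have := hl f
    rw [hf.symm, ← hu] at this
    exact u.mul_left_inj.1 this
  have hτe : τ ↑u⁻¹ = ↑u⁻¹ := by
    have : τ (↑u⁻¹ * u) = 1 := by rw [Units.inv_mul, hτ.one]
    rw [hτ.mul, hτf] at this
    rw [← Units.mul_right_inj u, this, Units.mul_inv]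
  have he : (↑u⁻¹ : A) ∈ altSpan F x₃ y₃ x₄ y₄ := by
    have h1 := h'.add_involution_mem hA hτ (x₁ * y₁ * ↑u⁻¹)
    have h3 : τ (x₁ * y₁) = u * (y₁ * x₁) * ↑u⁻¹ := by
      rw [Units.eq_mul_inv_iff_mul_eq, hu, hl, hσ.mul, hσ.x₁, hσ.y₁]
    rw [hτ.mul, hτe, h3, ← mul_assoc, ← mul_assoc, Units.inv_mul, one_mul, ← add_mul,
      h.left.swap.yx, add_assoc, ← two_smul F (y₁ * x₁), CharTwo.two_eq_zero, zero_smul,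
      add_zero, one_mul] at h1
    exact h1
  have hfe : f = 1 + β • (↑u⁻¹ : A) := by
    rw [← hu] at hsq ⊢
    rw [← Units.mul_left_inj u, hsq, add_mul, one_mul, smul_mul_assoc, Units.inv_mul]
  have hfm : f ∈ altSpan F x₃ y₃ x₄ y₄ := by
    rw [hfe]
    exact add_mem (Submodule.subset_span (by simp)) (Submodule.smul_mem _ _ he)
  obtain ⟨a, b, c, d, e, g, hz⟩ := _root_.mem_altSpan.1 hfm
  have hsq' := h'.mul_self_eq _ _ _ _ _ _ hz
  obtain rfl : b = 1 := by
    by_contra hb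
    refine h.notMem_vecSpan ?_
    have h1 : x₁ * y₁ + x₂ * y₂ = f - t • (1 : A) := by rw [hff, add_sub_cancel_right]
    have hone : (1 : A) ∈ vecSpan F x₁ y₁ x₂ y₂ := Submodule.subset_span (by simp)
    rw [h1]
    refine Submodule.sub_mem _ ?_ (Submodule.smul_mem _ _ hone)
    rw [hsq] at hsq'
    rw [← Submodule.smul_mem_iff _ (sub_ne_zero.2 (Ne.symm hb)), sub_smul, one_smul,
      sub_eq_sub_iff_add_eq_add.2 (hsq'.trans (add_comm _ _))]
    exact Submodule.sub_mem _ (Submodule.smul_mem _ _ hone) (Submodule.smul_mem _ _ hone)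
  exact ⟨a, c, d, e, g, hz⟩

/-- Two systems of Clifford generators of a biquaternion algebra in standard position. -/
structure IsStandard (m n r s m' n' r' s' t t' : F) (x₁ y₁ x₂ y₂ x₃ y₃ x₄ y₄ f : A) : Prop where
  left : IsBiCliff m n r s x₁ y₁ x₂ y₂
  right : IsBiCliff m' n' r' s' x₃ y₃ x₄ y₄
  eq_left : f = x₁ * y₁ + x₂ * y₂ + t • (1 : A)
  eq_right : f = x₃ * y₃ + x₄ * y₄ + t' • (1 : A)
  isUnit : IsUnit f
  mem : ∀ z ∈ ({x₃, y₃, x₄, y₄} : Set A), z * f ∈ Submodule.span F {x₁, y₁, x₂, y₂}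

theorem IsLink.isStandard (hf : IsLink σ x₃ y₃ x₄ y₄ f)
    (h : IsBiCliff m n r s x₁ y₁ x₂ y₂) (h' : IsBiCliff m' n' r' s' x₃ y₃ x₄ y₄)
    (hA : finrank F A = 16) (hσ : IsInvolution σ x₁ y₁ x₂ y₂)
    (hff : f = x₁ * y₁ + x₂ * y₂ + t • (1 : A)) (hff' : f = x₃ * y₃ + x₄ * y₄ + t' • (1 : A)) :
    IsStandard m n r s m' n' r' s' t t' x₁ y₁ x₂ y₂ x₃ y₃ x₄ y₄ f := by
  refine ⟨h, h', hff, hff', hf.isUnit, fun z hz ↦ ?_⟩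
  obtain ⟨a, b, c, d, e, g, hv⟩ := _root_.mem_altSpan.1 (hf.mul_mem_altSpan h h' hA hσ hz)
  have h1 := h.commutator_eq a b c d e g hff hv
  have h3 (a : A) : a + a = 0 := by rw [← two_smul F, CharTwo.two_eq_zero, zero_smul]
  rw [← mul_assoc, h'.mul_eq_mul_add hff' (Submodule.subset_span hz), add_mul, add_right_comm, h3,
    zero_add] at h1
  rw [h1]
  have hmem {w : A} (c : F) (hw : w ∈ ({x₁, y₁, x₂, y₂} : Set A)) :
      c • w ∈ Submodule.span F {x₁, y₁, x₂, y₂} :=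
    Submodule.smul_mem _ _ (Submodule.subset_span hw)
  exact add_mem (add_mem (add_mem (hmem _ (by simp)) (hmem _ (by simp))) (hmem _ (by simp)))
    (hmem _ (by simp))

theorem exists_isStandard [Infinite F] [Nontrivial A] (h : IsBiCliff m n r s x₁ y₁ x₂ y₂)
    (h' : IsBiCliff m' n' r' s' x₃ y₃ x₄ y₄) (hA : finrank F A = 16) :
    ∃ (m₁ n₁ r₁ s₁ m₂ n₂ r₂ s₂ t t' : F) (x₁ y₁ x₂ y₂ x₃ y₃ x₄ y₄ f : A),
      IsStandard m₁ n₁ r₁ s₁ m₂ n₂ r₂ s₂ t t' x₁ y₁ x₂ y₂ x₃ y₃ x₄ y₄ f ∧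
      Nonempty (CliffAlg F m n ≃ₐ[F] CliffAlg F m₁ n₁) ∧
      Nonempty (CliffAlg F r s ≃ₐ[F] CliffAlg F r₁ s₁) ∧
      Nonempty (CliffAlg F m' n' ≃ₐ[F] CliffAlg F m₂ n₂) ∧
      Nonempty (CliffAlg F r' s' ≃ₐ[F] CliffAlg F r₂ s₂) := by
  obtain ⟨σ, hσ⟩ := h.exists_isInvolution hA
  obtain ⟨τ, hτ⟩ := h'.exists_isInvolution hA
  obtain ⟨f, hf⟩ := h.exists_isLink hA hσ hτ
  obtain ⟨x₃, y₃, x₄, y₄, f, h', hf, hfn⟩ := hf.exists_notMem_vecSpan h h' hA hσ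
  obtain ⟨a, b, c, d, e, g, hfe⟩ := mem_altSpan.1 (hf.mem_altSpan h h'.left hA hσ)
  have hb : b ≠ 0 := by
    rintro rfl
    exact hfn (mem_vecSpan.2 ⟨a, c, d, e, g, by rw [hfe, zero_smul, add_zero]⟩)
  replace hf := hf.smul (inv_ne_zero hb)
  have hfe' : b⁻¹ • f = (b⁻¹ * a) • (1 : A) + (1 : F) • (x₁ * y₁ + x₂ * y₂) + (b⁻¹ * c) • x₁ +
      (b⁻¹ * d) • y₁ + (b⁻¹ * e) • x₂ + (b⁻¹ * g) • y₂ := by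
    rw [hfe, ← inv_mul_cancel₀ hb]
    module
  obtain ⟨t, ht⟩ := exists_translate hfe'
  have hσ' := hσ.translate (b⁻¹ * d) (b⁻¹ * c) (b⁻¹ * g) (b⁻¹ * e)
  have h₁ := h.translate (b⁻¹ * d) (b⁻¹ * c) (b⁻¹ * g) (b⁻¹ * e)
  obtain ⟨a', c', d', e', g', hfe₂⟩ := hf.mem_altSpan_right h₁ h' hA hσ' ht
  obtain ⟨t', ht'⟩ := exists_translate hfe₂
  exact ⟨_, _, _, _, _, _, _, _, t, t', _, _, _, _, _, _, _, _, _,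
    (hf.translate hσ.one d' c' g' e').isStandard h₁ (h'.translate d' c' g' e') hA hσ' ht ht',
    h.left.nonempty_algEquiv_translate _ _, h.right.nonempty_algEquiv_translate _ _,
    h'.left.nonempty_algEquiv_translate _ _, h'.right.nonempty_algEquiv_translate _ _⟩

end Standard

section LinearChange

variable {F : Type*} [Field F] [CharP F 2] {A : Type*} [Ring A] [Algebra F A]
  {m n r s t : F} {x y x₁ y₁ x₂ y₂ f : A} {a b c d a' b' c' d' : F}

theorem IsCliff.linearChange (h : IsCliff m n x y) (hdet : a * d + b * c = 1) :
    IsCliff (a ^ 2 * m + a * b + b ^ 2 * n) (c ^ 2 * m + c * d + d ^ 2 * n)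
      (a • x + b • y) (c • x + d • y) := by
  have h2 : (2 : F) = 0 := CharTwo.two_eq_zero
  constructor <;>
  · simp only [mul_add, add_mul, smul_mul_assoc, mul_smul_comm, h.xx, h.yy, h.yx]
    match_scalars <;> grind

theorem IsCliff.linearChange_mul (h : IsCliff m n x y) (hdet : a * d + b * c = 1) :
    (a • x + b • y) * (c • x + d • y) =
      x * y + (a * c * m + b * c + b * d * n) • (1 : A) := by
  simp only [mul_add, add_mul, smul_mul_assoc, mul_smul_comm, h.xx, h.yy, h.yx]
  match_scalars <;> grind

theorem IsCliff.nonempty_algEquiv_linearChange [Nontrivial A] (h : IsCliff m n x y)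
    (hdet : a * d + b * c = 1) : Nonempty (CliffAlg F m n ≃ₐ[F]
      CliffAlg F (a ^ 2 * m + a * b + b ^ 2 * n) (c ^ 2 * m + c * d + d ^ 2 * n)) := by
  have hx : x ∈ Algebra.adjoin F {x, y} := Algebra.subset_adjoin (by simp)
  have hy : y ∈ Algebra.adjoin F {x, y} := Algebra.subset_adjoin (by simp)
  exact CliffAlg.nonempty_algEquiv h (h.linearChange hdet)
    (add_mem (Subalgebra.smul_mem _ hx _) (Subalgebra.smul_mem _ hy _))
    (add_mem (Subalgebra.smul_mem _ hx _) (Subalgebra.smul_mem _ hy _))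

theorem IsBiCliff.linearChange (h : IsBiCliff m n r s x₁ y₁ x₂ y₂) (hdet : a * d + b * c = 1)
    (hdet' : a' * d' + b' * c' = 1) :
    IsBiCliff (a ^ 2 * m + a * b + b ^ 2 * n) (c ^ 2 * m + c * d + d ^ 2 * n)
      (a' ^ 2 * r + a' * b' + b' ^ 2 * s) (c' ^ 2 * r + c' * d' + d' ^ 2 * s)
      (a • x₁ + b • y₁) (c • x₁ + d • y₁) (a' • x₂ + b' • y₂) (c' • x₂ + d' • y₂) := by
  refine ⟨h.left.linearChange hdet, h.right.linearChange hdet', ?_, ?_, ?_, ?_⟩ <;>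
  · simp only [mul_add, add_mul, smul_mul_assoc, mul_smul_comm, h.xx, h.yy, h.yx, h.xy]
    module

theorem IsBiCliff.linearChange_eq (h : IsBiCliff m n r s x₁ y₁ x₂ y₂)
    (hdet : a * d + b * c = 1) (hdet' : a' * d' + b' * c' = 1)
    (hf : f = x₁ * y₁ + x₂ * y₂ + t • (1 : A)) :
    f = (a • x₁ + b • y₁) * (c • x₁ + d • y₁) + (a' • x₂ + b' • y₂) * (c' • x₂ + d' • y₂) +
      (t + (a * c * m + b * c + b * d * n) + (a' * c' * r + b' * c' + b' * d' * s)) •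
        (1 : A) := by
  have h2 : (2 : F) = 0 := CharTwo.two_eq_zero
  rw [h.left.linearChange_mul hdet, h.right.linearChange_mul hdet', hf]
  match_scalars <;> grind

end LinearChange

section Reduction

variable {F : Type*} [Field F] [CharP F 2] {A : Type*} [Ring A] [Algebra F A]

/-- Clifford generators in which the second system of generators has coefficients in `L`. -/
structure IsReduction {k : Type*} [Field k] [Algebra k F] (L : IntermediateField k F)
    (m n r s t a₁ a₂ b₁ b₂ : F) (x₁ y₁ x₂ y₂ f p q : A) : Prop where
  isBiCliff : IsBiCliff m n r s x₁ y₁ x₂ y₂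
  eq : f = x₁ * y₁ + x₂ * y₂ + t • (1 : A)
  left : p * f = a₁ • x₁ + a₂ • x₂
  right : q * f = b₁ • y₁ + b₂ • y₂
  ne : a₁ * b₁ + a₂ * b₂ ≠ 0
  m : m ∈ L
  n : n ∈ L
  r : r ∈ L
  s : s ∈ L
  t : t ∈ L
  a₁ : a₁ ∈ L
  a₂ : a₂ ∈ L
  b₁ : b₁ ∈ L
  b₂ : b₂ ∈ L

theorem IsReduction.swap {k : Type*} [Field k] [Algebra k F] {L : IntermediateField k F}
    {m n r s t a₁ a₂ b₁ b₂ : F} {x₁ y₁ x₂ y₂ f p q : A}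
    (h : IsReduction L m n r s t a₁ a₂ b₁ b₂ x₁ y₁ x₂ y₂ f p q) :
    IsReduction L r s m n t a₂ a₁ b₂ b₁ x₂ y₂ x₁ y₁ f p q where
  isBiCliff := h.isBiCliff.swap
  eq := by rw [add_comm (x₂ * y₂), ← h.eq]
  left := by rw [add_comm, ← h.left]
  right := by rw [add_comm, ← h.right]
  ne := by rw [add_comm]; exact h.ne
  m := h.r
  n := h.s
  r := h.m
  s := h.n
  t := h.t
  a₁ := h.a₂
  a₂ := h.a₁
  b₁ := h.b₂
  b₂ := h.b₁

variable {m n r s t κ β : F} {x₁ y₁ x₂ y₂ f : A}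

theorem IsBiCliff.mul_self_eq_add (h : IsBiCliff m n r s x₁ y₁ x₂ y₂)
    (hf : f = x₁ * y₁ + x₂ * y₂ + t • (1 : A)) :
    f * f = f + (t ^ 2 + t + m * n + r * s) • (1 : A) := by
  rw [h.mul_self_eq t 1 0 0 0 0 (z := f) (by rw [hf]; module)]
  module

theorem IsBiCliff.ne_zero_of_isUnit [Nontrivial A] (h : IsBiCliff m n r s x₁ y₁ x₂ y₂)
    (hf : f = x₁ * y₁ + x₂ * y₂ + t • (1 : A)) (hu : IsUnit f) :
    t ^ 2 + t + m * n + r * s ≠ 0 := by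
  intro h0
  have h1 := h.mul_self_eq_add hf
  rw [h0, zero_smul, add_zero] at h1
  have h2 : f = 1 := hu.mul_left_cancel (by rw [h1, mul_one])
  refine h.notMem_vecSpan ?_
  have hone : (1 : A) ∈ vecSpan F x₁ y₁ x₂ y₂ := Submodule.subset_span (by simp)
  rw [← add_sub_cancel_right (x₁ * y₁ + x₂ * y₂) (t • (1 : A)), ← hf, h2]
  exact Submodule.sub_mem _ hone (Submodule.smul_mem _ _ hone)

theorem mul_mul_mul_eq_smul_mul {z w : A} (hβ : β ≠ 0) (hf : f * f = f + β • (1 : A))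
    (hw : f * w = w * f + w) :
    z * (β⁻¹ • (f + 1)) * (w * (β⁻¹ • (f + 1))) = β⁻¹ • (z * w) := by
  have h3 (a : A) : a + a = 0 := by rw [← two_smul F, CharTwo.two_eq_zero, zero_smul]
  have h1 : (f + 1) * w = w * f := by rw [add_mul, one_mul, hw, add_assoc, h3, add_zero]
  have h2 : f * (f + 1) = β • (1 : A) := by rw [mul_add, mul_one, hf, add_right_comm, h3, zero_add]
  have h4 : f * (β⁻¹ • (f + 1)) = 1 := by
    rw [mul_smul_comm, h2, smul_smul, inv_mul_cancel₀ hβ, one_smul]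
  rw [mul_assoc, ← mul_assoc _ w, smul_mul_assoc, h1, smul_mul_assoc, mul_assoc w, h4, mul_one,
    mul_smul_comm]

/-- The second system of Clifford generators, in terms of the first one. -/
theorem IsBiCliff.exists_right (h : IsBiCliff m n r s x₁ y₁ x₂ y₂)
    (hf : f = x₁ * y₁ + x₂ * y₂ + t • (1 : A)) {a₁ a₂ b₁ b₂ : F}
    (hβ : β ≠ 0) (hβf : f * f = f + β • (1 : A)) (hκ : a₁ * b₁ + a₂ * b₂ = κ) (hκ0 : κ ≠ 0) :
    IsBiCliff (β⁻¹ * (a₁ ^ 2 * m + a₂ ^ 2 * r)) (β * (κ⁻¹) ^ 2 * (b₁ ^ 2 * n + b₂ ^ 2 * s))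
      (β⁻¹ * (b₂ ^ 2 * m + b₁ ^ 2 * r)) (β * (κ⁻¹) ^ 2 * (a₂ ^ 2 * n + a₁ ^ 2 * s))
      ((a₁ • x₁ + a₂ • x₂) * (β⁻¹ • (f + 1)))
      ((β * κ⁻¹) • ((b₁ • y₁ + b₂ • y₂) * (β⁻¹ • (f + 1))))
      ((b₂ • x₁ + b₁ • x₂) * (β⁻¹ • (f + 1)))
      ((β * κ⁻¹) • ((a₂ • y₁ + a₁ • y₂) * (β⁻¹ • (f + 1)))) := by
  have h2 : (2 : F) = 0 := CharTwo.two_eq_zero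
  have hm {c d e g : F} {w : A} (hw : w = c • x₁ + d • y₁ + e • x₂ + g • y₂) :
      f * w = w * f + w := by
    refine h.mul_eq_mul_add hf ?_
    simp only [Submodule.mem_span_insert, Submodule.mem_span_singleton]
    exact ⟨c, _, ⟨d, _, ⟨e, _, ⟨g, rfl⟩, rfl⟩, rfl⟩, by rw [hw]; abel⟩
  have hX (c e : F) : f * (c • x₁ + e • x₂) = (c • x₁ + e • x₂) * f + (c • x₁ + e • x₂) :=
    hm (c := c) (d := 0) (e := e) (g := 0) (by module)
  have hY (c e : F) : f * (c • y₁ + e • y₂) = (c • y₁ + e • y₂) * f + (c • y₁ + e • y₂) :=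
    hm (c := 0) (d := c) (e := 0) (g := e) (by module)
  refine ⟨⟨?_, ?_, ?_⟩, ⟨?_, ?_, ?_⟩, ?_, ?_, ?_, ?_⟩ <;>
  · simp only [smul_mul_assoc, mul_smul_comm _ _ (_ * _),
      mul_mul_mul_eq_smul_mul hβ hβf (hX _ _), mul_mul_mul_eq_smul_mul hβ hβf (hY _ _)]
    simp only [mul_add, add_mul, smul_mul_assoc, mul_smul_comm, h.xx, h.yy, h.yx, h.xy, h.left.xx,
      h.left.yy, h.left.yx, h.right.xx, h.right.yy, h.right.yx]
    match_scalars <;> grind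

end Reduction

section Descent

variable {k F : Type*} [Field k] [Field F] [Algebra k F]

theorem trdeg_eq (k L : Type*) [CommRing k] [CommRing L] [Algebra k L] :
    trdeg k L = Algebra.trdeg k L := rfl

open scoped IntermediateField.algebraAdjoinAdjoin in
theorem trdeg_adjoin_le (p : Fin 5 → F) :
    trdeg k (IntermediateField.adjoin k (Set.range p)) ≤ 5 := by
  rw [trdeg_eq, ← trdeg_add_eq k (Algebra.adjoin k (Set.range p)), 
    trdeg_eq_zero (R := Algebra.adjoin k (Set.range p)), add_zero,
    Algebra.adjoin_range_eq_range_aeval]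
  have h := lift_trdeg_le_of_surjective _ (MvPolynomial.aeval (R := k) p).rangeRestrict_surjective
  rw [MvPolynomial.trdeg_of_isDomain] at h
  simpa using h

theorem trdeg_top_le [Finite F] : trdeg k (⊤ : IntermediateField k F) ≤ 5 := by
  have : Algebra.IsAlgebraic k F := .of_finite k F
  rw [trdeg_eq, trdeg_eq_zero]
  exact zero_le

variable [CharP F 2] {A : Type*} [Ring A] [Algebra F A] [Nontrivial A]
  {a b : Fin 4 → F} {m n r s m' n' r' s' t a₁ a₂ b₁ b₂ : F} {L : IntermediateField k F}
  {x₁ y₁ x₂ y₂ x₃ y₃ x₄ y₄ f p q : A}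

theorem IsReduction.hasSmallDescent (h : IsReduction L m n r s t a₁ a₂ b₁ b₂ x₁ y₁ x₂ y₂ f p q)
    (h' : IsBiCliff m' n' r' s' x₃ y₃ x₄ y₄) (hA : finrank F A = 16) (hu : IsUnit f)
    (hL : trdeg k L ≤ 5) (hp : p ∈ Algebra.adjoin F {x₃, y₃}) (hq : q ∈ Algebra.adjoin F {x₃, y₃})
    (e₀ : Nonempty (CliffAlg F m n ≃ₐ[F] QuatAlg F (a 0) (b 0)))
    (e₁ : Nonempty (CliffAlg F r s ≃ₐ[F] QuatAlg F (a 1) (b 1)))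
    (e₂ : Nonempty (CliffAlg F m' n' ≃ₐ[F] QuatAlg F (a 2) (b 2)))
    (e₃ : Nonempty (CliffAlg F r' s' ≃ₐ[F] QuatAlg F (a 3) (b 3))) :
    HasSmallDescent k a b := by
  obtain ⟨hb, hf, hpf, hqf, hκ, hm, hn, hr, hs, ht, ha₁, ha₂, hb₁, hb₂⟩ := h
  have hβ := hb.ne_zero_of_isUnit hf hu
  have hff := hb.mul_self_eq_add hf
  have hβL : t ^ 2 + t + m * n + r * s ∈ L :=
    add_mem (add_mem (add_mem (pow_mem ht 2) ht) (mul_mem hm hn)) (mul_mem hr hs)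
  have hκL : a₁ * b₁ + a₂ * b₂ ∈ L := add_mem (mul_mem ha₁ hb₁) (mul_mem ha₂ hb₂)
  generalize t ^ 2 + t + m * n + r * s = β at hβ hff hβL
  obtain ⟨κ, hκe⟩ : ∃ κ, a₁ * b₁ + a₂ * b₂ = κ := ⟨_, rfl⟩
  rw [hκe] at hκ hκL
  have hnew := hb.exists_right hf hβ hff hκe hκ
  have h3 (a : A) : a + a = 0 := by rw [← two_smul F, CharTwo.two_eq_zero, zero_smul]
  have hg : f * (β⁻¹ • (f + 1)) = 1 := by
    rw [mul_smul_comm, mul_add, hff, mul_one, add_right_comm, h3, zero_add, smul_smul,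
      inv_mul_cancel₀ hβ, one_smul]
  have hL₁ : (a₁ • x₁ + a₂ • x₂) * (β⁻¹ • (f + 1)) = p := by
    rw [← hpf, mul_assoc, hg, mul_one]
  have hL₂ : (b₁ • y₁ + b₂ • y₂) * (β⁻¹ • (f + 1)) = q := by
    rw [← hqf, mul_assoc, hg, mul_one]
  have hp' : (a₁ • x₁ + a₂ • x₂) * (β⁻¹ • (f + 1)) ∈ Algebra.adjoin F {x₃, y₃} := by rwa [hL₁]
  have hq' : (β * κ⁻¹) • ((b₁ • y₁ + b₂ • y₂) * (β⁻¹ • (f + 1))) ∈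
      Algebra.adjoin F {x₃, y₃} := by
    rw [hL₂]
    exact Subalgebra.smul_mem _ hq _
  have hmem {z : A} (hzx : z * x₃ = x₃ * z) (hzy : z * y₃ = y₃ * z) :=
    hnew.mem_adjoin_right (z := z) hA
      (IsCliff.commute_of_mem_adjoin (F := F) (x := x₃) (y := y₃) hzx hzy hp')
      (IsCliff.commute_of_mem_adjoin (F := F) (x := x₃) (y := y₃) hzx hzy hq')
  have hx₄ := hmem h'.xx h'.xy
  have hy₄ := hmem h'.yx h'.yy
  obtain ⟨g₂⟩ := CliffAlg.nonempty_algEquiv h'.left hnew.left hp' hq'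
  obtain ⟨g₃⟩ := CliffAlg.nonempty_algEquiv hnew.right h'.right hx₄ hy₄
  obtain ⟨e₀⟩ := e₀
  obtain ⟨e₁⟩ := e₁
  obtain ⟨e₂⟩ := e₂
  obtain ⟨e₃⟩ := e₃
  have hsm {c : F} (hc : c ∈ L) {z : A} (hz : z ∈ Algebra.adjoin L {x₁, y₁, x₂, y₂}) :
      c • z ∈ Algebra.adjoin L {x₁, y₁, x₂, y₂} :=
    Subalgebra.smul_mem _ hz (⟨c, hc⟩ : L)
  have hx₁ : x₁ ∈ Algebra.adjoin L {x₁, y₁, x₂, y₂} := Algebra.subset_adjoin (by simp)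
  have hy₁ : y₁ ∈ Algebra.adjoin L {x₁, y₁, x₂, y₂} := Algebra.subset_adjoin (by simp)
  have hx₂ : x₂ ∈ Algebra.adjoin L {x₁, y₁, x₂, y₂} := Algebra.subset_adjoin (by simp)
  have hy₂ : y₂ ∈ Algebra.adjoin L {x₁, y₁, x₂, y₂} := Algebra.subset_adjoin (by simp)
  have hβ' : β⁻¹ ∈ L := inv_mem hβL
  have hκ' : κ⁻¹ ∈ L := inv_mem hκL
  have hgm : β⁻¹ • (f + 1) ∈ Algebra.adjoin L {x₁, y₁, x₂, y₂} := by
    refine hsm hβ' (add_mem ?_ (one_mem _))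
    rw [hf]
    exact add_mem (add_mem (mul_mem hx₁ hy₁) (mul_mem hx₂ hy₂)) (hsm ht (one_mem _))
  have hq4 {c d e g : F} (hc : c ∈ L) (hd : d ∈ L) (he : e ∈ L) (hg : g ∈ L) :
      c ^ 2 * e + d ^ 2 * g ∈ L :=
    add_mem (mul_mem (pow_mem hc 2) he) (mul_mem (pow_mem hd 2) hg)
  have hβκ : β * κ⁻¹ ^ 2 ∈ L := mul_mem hβL (pow_mem hκ' 2)
  exact hasSmallDescent_of_isBiCliff (a := a) (b := b) L hL
    (M := ![⟨m, hm⟩, ⟨r, hr⟩, ⟨_, mul_mem hβ' (hq4 ha₁ ha₂ hm hr)⟩,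
      ⟨_, mul_mem hβ' (hq4 hb₂ hb₁ hm hr)⟩])
    (N := ![⟨n, hn⟩, ⟨s, hs⟩, ⟨_, mul_mem hβκ (hq4 hb₁ hb₂ hn hs)⟩,
      ⟨_, mul_mem hβκ (hq4 ha₂ ha₁ hn hs)⟩]) hb hnew
    (mul_mem (add_mem (hsm ha₁ hx₁) (hsm ha₂ hx₂)) hgm)
    (hsm (mul_mem hβL hκ') (mul_mem (add_mem (hsm hb₁ hy₁) (hsm hb₂ hy₂)) hgm))
    (mul_mem (add_mem (hsm hb₂ hx₁) (hsm hb₁ hx₂)) hgm)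
    (hsm (mul_mem hβL hκ') (mul_mem (add_mem (hsm ha₂ hy₁) (hsm ha₁ hy₂)) hgm))
    (fun i ↦ match i with
      | 0 => ⟨e₀⟩
      | 1 => ⟨e₁⟩
      | 2 => ⟨g₂.symm.trans e₂⟩
      | 3 => ⟨g₃.trans e₃⟩)

end Descent

section Cases

variable {k F : Type*} [Field k] [Field F] [Algebra k F] {A : Type*} [Ring A] [Algebra F A]

/-- Up to a change of Clifford generators, the elements `f`, `x` and `y` have a reduction to an
extension of `k` of transcendence degree at most five. -/
def HasReduction (k : Type*) {F A : Type*} [Field k] [Field F] [Algebra k F] [Ring A] [Algebra F A]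
    (m n r s : F) (f x y : A) : Prop :=
  ∃ (L : IntermediateField k F) (m₁ n₁ r₁ s₁ t a₁ a₂ b₁ b₂ : F) (x₁ y₁ x₂ y₂ p q : A),
    IsReduction L m₁ n₁ r₁ s₁ t a₁ a₂ b₁ b₂ x₁ y₁ x₂ y₂ f p q ∧ trdeg k L ≤ 5 ∧
    p ∈ Algebra.adjoin F {x, y} ∧ q ∈ Algebra.adjoin F {x, y} ∧
    Nonempty (CliffAlg F m n ≃ₐ[F] CliffAlg F m₁ n₁) ∧
    Nonempty (CliffAlg F r s ≃ₐ[F] CliffAlg F r₁ s₁)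

variable {m n r s t d : F} {x₁ y₁ x₂ y₂ x y f p q : A}

variable [CharP F 2]

theorem HasReduction.swap (h : HasReduction k m n r s f x y) : HasReduction k r s m n f x y := by
  obtain ⟨L, m₁, n₁, r₁, s₁, t, a₁, a₂, b₁, b₂, x₁, y₁, x₂, y₂, p, q, h, hL, hp, hq, e, g⟩ := h
  exact ⟨L, _, _, _, _, t, _, _, _, _, _, _, _, _, p, q, h.swap, hL, hp, hq, g, e⟩

/-- A reduction all of whose coefficients are generated by five elements. -/
theorem IsBiCliff.hasReduction_of_mem (h : IsBiCliff m n r s x₁ y₁ x₂ y₂)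
    (hf : f = x₁ * y₁ + x₂ * y₂ + t • (1 : A)) (hp : p ∈ Algebra.adjoin F {x, y})
    (hq : q ∈ Algebra.adjoin F {x, y}) {a₁ a₂ b₁ b₂ : F} (hpf : p * f = a₁ • x₁ + a₂ • x₂)
    (hqf : q * f = b₁ • y₁ + b₂ • y₂) (hκ : a₁ * b₁ + a₂ * b₂ ≠ 0) (g : Fin 5 → F)
    (hg : ∀ L : IntermediateField k F, (∀ i, g i ∈ L) → m ∈ L ∧ n ∈ L ∧ r ∈ L ∧ s ∈ L ∧ t ∈ L ∧
      a₁ ∈ L ∧ a₂ ∈ L ∧ b₁ ∈ L ∧ b₂ ∈ L) : HasReduction k m n r s f x y := by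
  obtain ⟨hm, hn, hr, hs, ht, ha₁, ha₂, hb₁, hb₂⟩ := hg (.adjoin k (Set.range g))
    fun i ↦ IntermediateField.subset_adjoin k _ ⟨i, rfl⟩
  exact ⟨_, m, n, r, s, t, a₁, a₂, b₁, b₂, x₁, y₁, x₂, y₂, p, q,
    ⟨h, hf, hpf, hqf, hκ, hm, hn, hr, hs, ht, ha₁, ha₂, hb₁, hb₂⟩, trdeg_adjoin_le g, hp, hq,
    ⟨.refl⟩, ⟨.refl⟩⟩

theorem HasReduction.of_linearChange [Nontrivial A] {a b c d a' b' c' d' : F}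
    (h : IsBiCliff m n r s x₁ y₁ x₂ y₂) (hdet : a * d + b * c = 1)
    (hdet' : a' * d' + b' * c' = 1)
    (hr : HasReduction k (a ^ 2 * m + a * b + b ^ 2 * n) (c ^ 2 * m + c * d + d ^ 2 * n)
      (a' ^ 2 * r + a' * b' + b' ^ 2 * s) (c' ^ 2 * r + c' * d' + d' ^ 2 * s) f x y) :
    HasReduction k m n r s f x y := by
  obtain ⟨L, m₁, n₁, r₁, s₁, t, a₁, a₂, b₁, b₂, x₁, y₁, x₂, y₂, p, q, hR, hL, hp, hq, ⟨e⟩, ⟨e'⟩⟩ :=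
    hr
  obtain ⟨g⟩ := h.left.nonempty_algEquiv_linearChange hdet
  obtain ⟨g'⟩ := h.right.nonempty_algEquiv_linearChange hdet'
  exact ⟨L, m₁, n₁, r₁, s₁, t, a₁, a₂, b₁, b₂, x₁, y₁, x₂, y₂, p, q, hR, hL, hp, hq,
    ⟨g.trans e⟩, ⟨g'.trans e'⟩⟩

theorem IsBiCliff.hasReduction_of_eq (h : IsBiCliff m n r s x₁ y₁ x₂ y₂)
    (hf : f = x₁ * y₁ + x₂ * y₂ + t • (1 : A)) (hp : p ∈ Algebra.adjoin F {x, y})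
    (hq : q ∈ Algebra.adjoin F {x, y}) (hpf : p * f = x₁ + x₂) (hqf : q * f = y₁ + d • y₂)
    (hd : d ≠ 0) (hd' : 1 + d ≠ 0) (hrel : r = m * d ∨ n * r = d ^ 2 * m * s) :
    HasReduction k m n r s f x y := by
  suffices H : ∃ g : Fin 5 → F, ∀ L : IntermediateField k F, (∀ i, g i ∈ L) →
      m ∈ L ∧ n ∈ L ∧ r ∈ L ∧ s ∈ L ∧ t ∈ L ∧ d ∈ L by
    obtain ⟨g, hg⟩ := H
    refine h.hasReduction_of_mem hf hp hq (a₁ := 1) (a₂ := 1) (b₁ := 1) (b₂ := d)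
      (by rw [hpf, one_smul, one_smul]) (by rw [hqf, one_smul]) (by simpa using hd') g
      fun L hL ↦ ?_
    obtain ⟨hm, hn, hr, hs, ht, hd⟩ := hg L hL
    exact ⟨hm, hn, hr, hs, ht, one_mem L, one_mem L, one_mem L, hd⟩
  rcases eq_or_ne r (m * d) with rfl | hrm
  · refine ⟨![m, n, s, t, d], fun L hL ↦ ?_⟩
    have hm : m ∈ L := hL 0
    have hd : d ∈ L := hL 4
    exact ⟨hm, hL 1, mul_mem hm hd, hL 2, hL 3, hd⟩
  replace hrel := hrel.resolve_left hrm
  rcases eq_or_ne r 0 with rfl | hr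
  · have hm : m ≠ 0 := by
      rintro rfl
      simp at hrm
    have hs : s = 0 := by simpa [hd, hm] using hrel.symm
    refine ⟨![m, n, t, d, 0], fun L hL ↦ ⟨hL 0, hL 1, zero_mem L, ?_, hL 2, hL 3⟩⟩
    rw [hs]
    exact zero_mem L
  · refine ⟨![m, r, s, t, d], fun L hL ↦ ?_⟩
    have hm : m ∈ L := hL 0
    have hr' : r ∈ L := hL 1
    have hs : s ∈ L := hL 2
    have hd : d ∈ L := hL 4
    refine ⟨hm, ?_, hr', hs, hL 3, hd⟩
    rw [← mul_inv_cancel_right₀ hr n, hrel]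
    exact mul_mem (mul_mem (mul_mem (pow_mem hd 2) hm) hs) (inv_mem hr')

theorem IsBiCliff.hasReduction_of_add [Nontrivial A] (h : IsBiCliff m n r s x₁ y₁ x₂ y₂)
    (hf : f = x₁ * y₁ + x₂ * y₂ + t • (1 : A)) (hp : p ∈ Algebra.adjoin F {x, y})
    (hq : q ∈ Algebra.adjoin F {x, y}) (hpf : p * f = x₁ + x₂) (hqf : q * f = y₁ + d • y₂)
    (hd : d ≠ 0) (hd' : 1 + d ≠ 0) : HasReduction k m n r s f x y := by
  have h2 : (2 : F) = 0 := CharTwo.two_eq_zero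
  rcases eq_or_ne r (m * d) with hrm | hrm
  · exact h.hasReduction_of_eq hf hp hq hpf hqf hd hd' (.inl hrm)
  have hrm' : r + m * d ≠ 0 := fun h0 ↦ hrm (CharTwo.add_eq_zero.1 h0)
  obtain ⟨c, hc⟩ : ∃ c, c * (r + m * d) = r * n + d ^ 2 * m * s :=
    ⟨_, div_mul_cancel₀ _ hrm'⟩
  have hdet : (1 : F) * 1 + 0 * c = 1 := by ring
  have hdet' : (1 : F) * 1 + 0 * (c * d⁻¹) = 1 := by ring
  refine HasReduction.of_linearChange h hdet hdet' ?_
  refine (h.linearChange hdet hdet').hasReduction_of_eq (h.linearChange_eq hdet hdet' hf) hp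
    (add_mem hq (Subalgebra.smul_mem _ hp c)) (by rw [hpf]; module) (d := d) ?_ hd hd' (.inr ?_)
  · rw [add_mul, hqf, smul_mul_assoc, hpf]
    match_scalars <;> field_simp
  · have h3 : d⁻¹ * d = 1 := inv_mul_cancel₀ hd
    generalize d⁻¹ = e at h3
    grind

theorem exists_combination {a b c d : F} (h : a * d + b * c = 0) :
    ∃ i j i' j' : F, i * j' + j * i' = 1 ∧ i' * a + j' * c = 0 ∧ i' * b + j' * d = 0 := by
  have h2 : (2 : F) = 0 := CharTwo.two_eq_zero
  by_cases ha : a = 0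
  · by_cases hb : b = 0
    · exact ⟨0, 1, 1, 0, by simp, by simp [ha], by simp [hb]⟩
    · refine ⟨1, 0, d / b, 1, by simp, ?_, ?_⟩ <;> field_simp <;> grind
  · refine ⟨1, 0, c / a, 1, by simp, ?_, ?_⟩ <;> field_simp <;> grind

theorem exists_det_eq_one (a b : F) :
    ∃ e c d c' d' : F, (e = 0 ∨ e = 1) ∧ c * d' + d * c' = 1 ∧ a = e * c ∧ b = e * d := by
  by_cases ha : a = 0
  · by_cases hb : b = 0
    · exact ⟨0, 1, 0, 0, 1, by simp, by simp, by simp [ha], by simp [hb]⟩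
    · exact ⟨1, a, b, b⁻¹, 0, by simp, by simp [hb], by simp, by simp⟩
  · exact ⟨1, a, b, 0, a⁻¹, by simp, by simp [ha], by simp, by simp⟩

variable {α₁ α₂ α₃ α₄ γ₁ γ₂ γ₃ γ₄ : F}

theorem IsBiCliff.hasReduction_of_det_eq_zero [Nontrivial A] (h : IsBiCliff m n r s x₁ y₁ x₂ y₂)
    (hf : f = x₁ * y₁ + x₂ * y₂ + t • (1 : A))
    (hx : x * f = α₁ • x₁ + α₂ • y₁ + α₃ • x₂ + α₄ • y₂)
    (hy : y * f = γ₁ • x₁ + γ₂ • y₁ + γ₃ • x₂ + γ₄ • y₂)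
    (h₁ : α₁ * γ₂ + α₂ * γ₁ = 0) (h₂ : α₃ * γ₄ + α₄ * γ₃ ≠ 0) :
    HasReduction k m n r s f x y := by
  have hxm : x ∈ Algebra.adjoin F {x, y} := Algebra.subset_adjoin (by simp)
  have hym : y ∈ Algebra.adjoin F {x, y} := Algebra.subset_adjoin (by simp)
  obtain ⟨i, j, i', j', hij, hα, hγ⟩ := exists_combination h₁
  obtain ⟨e, c, d, c', d', he, hdet, hc, hd⟩ :=
    exists_det_eq_one (i * α₁ + j * γ₁) (i * α₂ + j * γ₂)
  obtain ⟨D, hD⟩ : ∃ D, D * (α₃ * γ₄ + α₄ * γ₃) = 1 := ⟨_, inv_mul_cancel₀ h₂⟩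
  have h2 : (2 : F) = 0 := CharTwo.two_eq_zero
  have hdet' : (i * α₃ + j * γ₃) * (D * (i' * α₄ + j' * γ₄)) +
      (i * α₄ + j * γ₄) * (D * (i' * α₃ + j' * γ₃)) = 1 := by
    linear_combination (i * j' + j * i') * hD + hij + D * (i * i' * α₃ * α₄ + j * j' * γ₃ * γ₄) * h2
  refine HasReduction.of_linearChange h hdet hdet' ?_
  refine (h.linearChange hdet hdet').hasReduction_of_mem (h.linearChange_eq hdet hdet' hf)
    (p := i • x + j • y) (q := D • (i' • x + j' • y))
    (add_mem (Subalgebra.smul_mem _ hxm _) (Subalgebra.smul_mem _ hym _))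
    (Subalgebra.smul_mem _ (add_mem (Subalgebra.smul_mem _ hxm _) (Subalgebra.smul_mem _ hym _)) _)
    (a₁ := e) (a₂ := 1) (b₁ := 0) (b₂ := 1) ?_ ?_ (by simp) ![_, _, _, _, _]
    fun L hL ↦ ⟨hL 0, hL 1, hL 2, hL 3, hL 4, ?_, one_mem L, zero_mem L, one_mem L⟩
  · rw [add_mul, smul_mul_assoc, smul_mul_assoc, hx, hy]
    match_scalars <;> grind
  · rw [smul_mul_assoc, add_mul, smul_mul_assoc, smul_mul_assoc, hx, hy]
    match_scalars <;> grind
  · rcases he with rfl | rfl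
    exacts [zero_mem L, one_mem L]

theorem IsBiCliff.hasReduction [Nontrivial A] (h : IsBiCliff m n r s x₁ y₁ x₂ y₂)
    (hf : f = x₁ * y₁ + x₂ * y₂ + t • (1 : A))
    (hx : x * f = α₁ • x₁ + α₂ • y₁ + α₃ • x₂ + α₄ • y₂)
    (hy : y * f = γ₁ • x₁ + γ₂ • y₁ + γ₃ • x₂ + γ₄ • y₂)
    (hne : α₁ * γ₂ + α₂ * γ₁ + (α₃ * γ₄ + α₄ * γ₃) ≠ 0) :
    HasReduction k m n r s f x y := by
  by_cases h₁ : α₁ * γ₂ + α₂ * γ₁ = 0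
  · exact h.hasReduction_of_det_eq_zero hf hx hy h₁ (by simpa [h₁] using hne)
  by_cases h₂ : α₃ * γ₄ + α₄ * γ₃ = 0
  · refine (h.swap.hasReduction_of_det_eq_zero (t := t) (α₁ := α₃) (α₂ := α₄) (α₃ := α₁) (α₄ := α₂)
      (γ₁ := γ₃) (γ₂ := γ₄) (γ₃ := γ₁) (γ₄ := γ₂) ?_ ?_ ?_ h₂ h₁).swap
    · rw [hf, add_comm (x₁ * y₁)]
    · rw [hx]; abel
    · rw [hy]; abel
  have hxm : x ∈ Algebra.adjoin F {x, y} := Algebra.subset_adjoin (by simp)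
  have hym : y ∈ Algebra.adjoin F {x, y} := Algebra.subset_adjoin (by simp)
  have hD₁ := inv_mul_cancel₀ h₁
  have hD₂ := inv_mul_cancel₀ h₂
  set D₁ := (α₁ * γ₂ + α₂ * γ₁)⁻¹
  set D₂ := (α₃ * γ₄ + α₄ * γ₃)⁻¹
  have hdet : α₁ * (D₁ * γ₂) + α₂ * (D₁ * γ₁) = 1 := by rw [← hD₁]; ring
  have hdet' : α₃ * (D₂ * γ₄) + α₄ * (D₂ * γ₃) = 1 := by rw [← hD₂]; ring
  refine HasReduction.of_linearChange h hdet hdet' ?_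
  refine (h.linearChange hdet hdet').hasReduction_of_add (h.linearChange_eq hdet hdet' hf) hxm
    (Subalgebra.smul_mem _ hym D₁) (by rw [hx]; abel) (d := D₁ * (α₃ * γ₄ + α₄ * γ₃)) ?_
    (mul_ne_zero (inv_ne_zero h₁) h₂) ?_
  · rw [smul_mul_assoc, hy]
    match_scalars <;> grind
  · rw [← hD₁, ← mul_add]
    exact mul_ne_zero (inv_ne_zero h₁) hne

variable {m' n' r' s' t' : F} {x₃ y₃ x₄ y₄ : A}

theorem IsStandard.hasReduction [Nontrivial A]
    (h : IsStandard m n r s m' n' r' s' t t' x₁ y₁ x₂ y₂ x₃ y₃ x₄ y₄ f) :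
    HasReduction k m n r s f x₃ y₃ := by
  have h2 : (2 : F) = 0 := CharTwo.two_eq_zero
  have hmem {z : A} (hz : z ∈ ({x₃, y₃, x₄, y₄} : Set A)) :
      ∃ a b c d : F, z * f = a • x₁ + b • y₁ + c • x₂ + d • y₂ := by
    have hz := h.mem z hz
    simp only [Submodule.mem_span_insert, Submodule.mem_span_singleton] at hz
    obtain ⟨a, _, ⟨b, _, ⟨c, _, ⟨d, rfl⟩, rfl⟩, rfl⟩, hz⟩ := hz
    exact ⟨a, b, c, d, by rw [hz]; abel⟩
  obtain ⟨α₁, α₂, α₃, α₄, hx⟩ := hmem (z := x₃) (by simp)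
  obtain ⟨γ₁, γ₂, γ₃, γ₄, hy⟩ := hmem (z := y₃) (by simp)
  refine h.left.hasReduction h.eq_left hx hy fun h0 ↦ ?_
  have hb := h.left
  have h1 : x₃ * f * (y₃ * f) + y₃ * f * (x₃ * f) = 0 := by
    rw [← zero_smul F (1 : A), ← h0, hx, hy]
    simp only [mul_add, add_mul, smul_mul_assoc, mul_smul_comm, hb.xx, hb.yy, hb.yx, hb.xy,
      hb.left.xx, hb.left.yy, hb.left.yx, hb.right.xx, hb.right.yy, hb.right.yx]
    match_scalars <;> grind
  have hff := hb.mul_self_eq_add h.eq_left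
  have hβ := hb.ne_zero_of_isUnit h.eq_left h.isUnit
  generalize t ^ 2 + t + m * n + r * s = β at hff hβ
  have hfx : f * x₃ = x₃ * f + x₃ :=
    h.right.mul_eq_mul_add h.eq_right (Submodule.subset_span (by simp))
  have hfy : f * y₃ = y₃ * f + y₃ :=
    h.right.mul_eq_mul_add h.eq_right (Submodule.subset_span (by simp))
  have h3 : x₃ * f * (y₃ * f) + y₃ * f * (x₃ * f) = β • (1 : A) := by
    rw [mul_assoc, ← mul_assoc f, hfy, mul_assoc y₃, ← mul_assoc f, hfx, add_mul, add_mul,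
      mul_assoc, mul_assoc, hff]
    simp only [mul_add, mul_smul_comm, mul_one, ← mul_assoc, h.right.left.yx, add_mul, one_mul]
    match_scalars <;> grind
  rw [h1] at h3
  exact hβ ((smul_eq_zero.1 h3.symm).resolve_right one_ne_zero)

end Cases

section Final

variable {k F : Type*} [Field k] [Field F] [Algebra k F] [CharP F 2]

open CliffAlg in
theorem exists_isBiCliff_of_algEquiv {m n : Fin 4 → F}
    (ρ : (((CliffAlg F (m 0) (n 0) ⊗[F] CliffAlg F (m 1) (n 1)) ⊗[F] CliffAlg F (m 2) (n 2)) ⊗[F]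
      CliffAlg F (m 3) (n 3)) ≃ₐ[F] Matrix (Fin 16) (Fin 16) F) :
    ∃ x₃ y₃ x₄ y₄ : BiCliffAlg F (m 0) (n 0) (m 1) (n 1),
      IsBiCliff (m 2) (n 2) (m 3) (n 3) x₃ y₃ x₄ y₄ :=
  exists_isBiCliff_of_split (BiCliffAlg.finrank_eq _ _ _ _)
    (Algebra.TensorProduct.includeLeft (S := F)
      (B := BiCliffAlg F (m 2) (n 2) (m 3) (n 3)))
    ((BiCliffAlg.isBiCliff (m 2) (n 2) (m 3) (n 3)).map Algebra.TensorProduct.includeRight)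
    (fun z ↦ by simp [Commute, SemiconjBy]) (fun z ↦ by simp [Commute, SemiconjBy])
    (fun z ↦ by simp [Commute, SemiconjBy]) (fun z ↦ by simp [Commute, SemiconjBy])
    (((Algebra.TensorProduct.assoc F F F (BiCliffAlg F (m 0) (n 0) (m 1) (n 1))
      (CliffAlg F (m 2) (n 2)) (CliffAlg F (m 3) (n 3))).symm.trans ρ : _ ≃ₐ[F] _) : _ →ₐ[F] _)

open CliffAlg in
theorem hasSmallDescent_of_algEquiv {a b m n : Fin 4 → F}
    (ρ : (((CliffAlg F (m 0) (n 0) ⊗[F] CliffAlg F (m 1) (n 1)) ⊗[F] CliffAlg F (m 2) (n 2)) ⊗[F]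
      CliffAlg F (m 3) (n 3)) ≃ₐ[F] Matrix (Fin 16) (Fin 16) F)
    (e : ∀ i, CliffAlg F (m i) (n i) ≃ₐ[F] QuatAlg F (a i) (b i)) : HasSmallDescent k a b := by
  obtain ⟨x₃, y₃, x₄, y₄, h'⟩ := exists_isBiCliff_of_algEquiv ρ
  have h := BiCliffAlg.isBiCliff (m 0) (n 0) (m 1) (n 1)
  have hA := BiCliffAlg.finrank_eq (m 0) (n 0) (m 1) (n 1)
  cases finite_or_infinite F
  · have hmem z : z ∈ Algebra.adjoin (⊤ : IntermediateField k F)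
        {x (m 0) (n 0) ⊗ₜ[F] (1 : CliffAlg F (m 1) (n 1)), y (m 0) (n 0) ⊗ₜ 1,
          1 ⊗ₜ x (m 1) (n 1), 1 ⊗ₜ y (m 1) (n 1)} := by
      have hz : z ∈ (⊤ : Subalgebra F _) := trivial
      rw [← h.adjoin_eq_top hA] at hz
      induction hz using Algebra.adjoin_induction with
      | mem z hz => exact Algebra.subset_adjoin hz
      | algebraMap c =>
        exact Subalgebra.algebraMap_mem _ (⟨c, trivial⟩ : (⊤ : IntermediateField k F))
      | add z w _ _ hz hw => exact add_mem hz hw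
      | mul z w _ _ hz hw => exact mul_mem hz hw
    exact hasSmallDescent_of_isBiCliff ⊤ trdeg_top_le (M := fun i ↦ ⟨m i, trivial⟩)
      (N := fun i ↦ ⟨n i, trivial⟩) h h' (hmem _) (hmem _) (hmem _) (hmem _) fun i ↦ ⟨e i⟩
  · obtain ⟨m₁, n₁, r₁, s₁, m₂, n₂, r₂, s₂, t, t', x₁, y₁, x₂, y₂, x₃, y₃, x₄, y₄, f, hS, ⟨e₀⟩,
      ⟨e₁⟩, ⟨e₂⟩, ⟨e₃⟩⟩ := exists_isStandard h h' hA
    obtain ⟨L, _, _, _, _, _, _, _, _, _, _, _, _, _, p, q, hR, hL, hp, hq, ⟨g⟩, ⟨g'⟩⟩ :=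
      hS.hasReduction (k := k)
    exact hR.hasSmallDescent hS.right hA hS.isUnit hL hp hq
      ⟨(e₀.trans g).symm.trans (e 0)⟩ ⟨(e₁.trans g').symm.trans (e 1)⟩ ⟨e₂.symm.trans (e 2)⟩
      ⟨e₃.symm.trans (e 3)⟩

end Final

set_option maxSynthPendingDepth 3 in
set_option maxHeartbeats 1000000 in
set_option synthInstance.maxHeartbeats 1000000 in
theorem stmt5 (k F : Type*) [Field k] [Field F] [Algebra k F] [CharP k 2]
    (a b : Fin 4 → F) (hb : ∀ i, b i ≠ 0)
    (hsplit : Nonempty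
      ((((QuatAlg F (a 0) (b 0) ⊗[F] QuatAlg F (a 1) (b 1)) ⊗[F]
          QuatAlg F (a 2) (b 2)) ⊗[F] QuatAlg F (a 3) (b 3)) ≃ₐ[F]
        Matrix (Fin 16) (Fin 16) F)) :
    ∃ L : IntermediateField k F, trdeg k L ≤ 5 ∧
      ∃ a' b' : Fin 4 → L, (∀ i, b' i ≠ 0) ∧
        (∀ i, Nonempty (QuatAlg F (a' i : F) (b' i : F) ≃ₐ[F] QuatAlg F (a i) (b i))) ∧
        Nonempty
          ((((QuatAlg L (a' 0) (b' 0) ⊗[L] QuatAlg L (a' 1) (b' 1)) ⊗[L]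
              QuatAlg L (a' 2) (b' 2)) ⊗[L] QuatAlg L (a' 3) (b' 3)) ≃ₐ[L]
            Matrix (Fin 16) (Fin 16) L) := by
  have : CharP F 2 := charP_of_injective_algebraMap (algebraMap k F).injective 2
  have e (i : Fin 4) : QuatAlg F (b i * ((b i)⁻¹ * a i)) (cliffSlot (b i) ((b i)⁻¹ * a i)) ≃ₐ[F]
      QuatAlg F (a i) (b i) := by
    rw [cliffSlot_of_ne_zero _ (hb i), mul_inv_cancel_left₀ (hb i)]
  obtain ⟨ρ⟩ := hsplit
  exact hasSmallDescent_of_algEquiv (m := b) (n := fun i ↦ (b i)⁻¹ * a i)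
    ((Algebra.TensorProduct.congr (Algebra.TensorProduct.congr
      (Algebra.TensorProduct.congr (e 0) (e 1)) (e 2)) (e 3)).trans ρ) e
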